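/- arXiv:1711.02907 — 3 statements merged into one kernel-verified Lean document; each statement's English description precedes it below -/
import Mathlib

section
/- Fix $T=1$, $n\in\mathbb{N}_+$ and for $r\in(0,1]$ let $\lceil r\rceil^n$ denote the smallest grid point $k/n$ ($k=1,\dots,n$) with $r\le k/n$, and $\lceil 0\rceil^n=0$. Let $\alpha,\beta,\beta'\in(0,1)$ satisfy $\beta'>\alpha>1-\beta$. Then there is a constant $C=C(\alpha,\beta,\beta')$, independent of $n$, such that for all grid points $s=\lceil s\rceil^n$ and all $t\in(s,1]$: $\int_s^t (t-r)^{\alpha+\beta-1}\int_s^r \frac{(\lceil r\rceil^n-\lceil u\rceil^n)^{\beta'}}{(r-u)^{\alpha+1}}\,du\,dr \le C (t-s)^{\beta+\beta'}$. -/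
open intervalIntegral

/-- Right grid projection on the uniform grid `{k/n : k = 0,…,n}` of `[0,1]`:
`ceilG n r` is the smallest grid point `≥ r` (and `0` for `r ≤ 0`). -/
noncomputable def ceilG (n : ℕ) (r : ℝ) : ℝ := (⌈n * r⌉ : ℝ) / n

open MeasureTheory Set

/-- Distance from `x` to the left end point of the unit cell `(k, k + 1]` containing it. -/
noncomputable def cellOffset (x : ℝ) : ℝ := x - ⌈x⌉ + 1

theorem cellOffset_pos (x : ℝ) : 0 < cellOffset x := by
  have := Int.ceil_lt_add_one x
  unfold cellOffset
  linarith

theorem cellOffset_le_one (x : ℝ) : cellOffset x ≤ 1 := by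
  have := Int.le_ceil x
  unfold cellOffset
  linarith

theorem cellOffset_of_mem_Ioc {x : ℝ} (hx : x ∈ Ioc (0 : ℝ) 1) : cellOffset x = x := by
  have : ⌈x⌉ = 1 := by
    rw [Int.ceil_eq_iff]
    exact ⟨by simpa using hx.1, by simpa using hx.2⟩
  simp [cellOffset, this]

theorem periodic_cellOffset_rpow (p : ℝ) :
    Function.Periodic (fun x => cellOffset x ^ p) 1 := by
  intro x
  simp only [cellOffset, Int.ceil_add_one]
  push_cast
  ring_nf

theorem intervalIntegrable_cellOffset_rpow {p : ℝ} (hp : -1 < p) (a b : ℝ) :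
    IntervalIntegrable (fun x => cellOffset x ^ p) volume a b := by
  refine (periodic_cellOffset_rpow p).intervalIntegrable one_ne_zero (t := 0) ?_ a b
  refine (intervalIntegrable_rpow' hp).congr fun x hx => ?_
  rw [zero_add, uIoc_of_le zero_le_one] at hx
  simp only [cellOffset_of_mem_Ioc hx]

theorem integral_cellOffset_rpow_le {p : ℝ} (hp : -1 < p) {a b : ℝ} (hab : a ≤ b) :
    ∫ x in a..b, cellOffset x ^ p ≤ (b - a + 1) / (p + 1) := by
  have hint := intervalIntegrable_cellOffset_rpow hp
  have hper := periodic_cellOffset_rpow p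
  have hunit : ∫ x in a..a + 1, cellOffset x ^ p = 1 / (p + 1) := by
    rw [hper.intervalIntegral_add_eq a 0, zero_add,
      intervalIntegral.integral_congr_Ioo_of_le (g := fun x => x ^ p) zero_le_one, integral_rpow (Or.inl hp)]
    · simp [Real.zero_rpow (by linarith : p + 1 ≠ 0)]
    · intro x hx
      simp only [cellOffset_of_mem_Ioc (Ioo_subset_Ioc_self hx)]
  have hle : b ≤ a + ⌈b - a⌉ • (1 : ℝ) := by
    have := Int.le_ceil (b - a)
    simp only [zsmul_eq_mul, mul_one]
    linarith
  calc
    ∫ x in a..b, cellOffset x ^ p ≤ ∫ x in a..a + ⌈b - a⌉ • (1 : ℝ), cellOffset x ^ p :=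
      intervalIntegral.integral_mono_interval le_rfl hab hle
        (.of_forall fun x => (Real.rpow_pos_of_pos (cellOffset_pos x) p).le) (hint _ _)
    _ = ⌈b - a⌉ * (1 / (p + 1)) := by
      rw [hper.intervalIntegral_add_zsmul_eq _ _ hint, hunit, zsmul_eq_mul]
    _ ≤ (b - a + 1) * (1 / (p + 1)) := by
      have : 0 < p + 1 := by linarith
      have := (Int.ceil_lt_add_one (b - a)).le
      gcongr
    _ = (b - a + 1) / (p + 1) := by ring

theorem intervalIntegral_mono_of_nonneg {f g : ℝ → ℝ} {a b : ℝ} (hab : a ≤ b)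
    (hg : IntervalIntegrable g volume a b) (hf : ∀ x ∈ Ioo a b, 0 ≤ f x)
    (hfg : ∀ x ∈ Ioo a b, f x ≤ g x) : ∫ x in a..b, f x ≤ ∫ x in a..b, g x := by
  simp only [intervalIntegral.integral_of_le hab, integral_Ioc_eq_integral_Ioo]
  exact integral_mono_of_nonneg (ae_restrict_of_forall_mem measurableSet_Ioo hf)
    (hg.1.mono_set Ioo_subset_Ioc_self) (ae_restrict_of_forall_mem measurableSet_Ioo hfg)

theorem ceilG_mono (n : ℕ) : Monotone (ceilG n) := by
  intro u r hur
  unfold ceilG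
  gcongr

/-- Grid increments are controlled by true increments up to the inverse relative distance to the
left end of the cell. -/
theorem ceilG_sub_le {n : ℕ} (hn : 0 < n) {u r : ℝ} (hur : u ≤ r) :
    ceilG n r - ceilG n u ≤ 2 / cellOffset (n * r) * (r - u) := by
  have hn' : (0 : ℝ) < n := by exact_mod_cast hn
  have hA := cellOffset_pos (n * r)
  have hA1 := cellOffset_le_one (n * r)
  have hk := Int.le_ceil ((n : ℝ) * u)
  rcases (Int.ceil_mono (mul_le_mul_of_nonneg_left hur hn'.le)).eq_or_lt with h | h
  · have hnn : 0 ≤ 2 / cellOffset (n * r) * (r - u) :=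
      mul_nonneg (by positivity) (sub_nonneg.2 hur)
    simpa [ceilG, h] using hnn
  · have h' : ((⌈(n : ℝ) * u⌉ : ℤ) : ℝ) + 1 ≤ ⌈(n : ℝ) * r⌉ := by exact_mod_cast h
    have hle : (⌈(n : ℝ) * r⌉ - ⌈(n : ℝ) * u⌉ : ℝ) * cellOffset (n * r) ≤ 2 * (n * (r - u)) := by
      have hd : cellOffset (n * r) ≤ n * (r - u) := by
        unfold cellOffset
        linarith
      have hm : (⌈(n : ℝ) * r⌉ - ⌈(n : ℝ) * u⌉ : ℝ) ≤ n * (r - u) + 1 := by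
        have := Int.ceil_lt_add_one ((n : ℝ) * r)
        linarith
      nlinarith
    rw [ceilG, ceilG, ← sub_div, div_mul_eq_mul_div, div_le_div_iff₀ hn' hA]
    linarith

theorem integral_ceilG_sub_rpow_div_nonneg {p q : ℝ} (n : ℕ) {s r : ℝ} (hsr : s ≤ r) :
    0 ≤ ∫ u in s..r, (ceilG n r - ceilG n u) ^ q / (r - u) ^ p :=
  intervalIntegral.integral_nonneg hsr fun _ hu =>
    div_nonneg (Real.rpow_nonneg (sub_nonneg.2 (ceilG_mono n hu.2)) _)
      (Real.rpow_nonneg (sub_nonneg.2 hu.2) _)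

theorem integral_ceilG_sub_rpow_div_le {α γ : ℝ} (hγ : 0 ≤ γ) (hαγ : α < γ) {n : ℕ}
    (hn : 0 < n) {s r : ℝ} (hsr : s ≤ r) :
    ∫ u in s..r, (ceilG n r - ceilG n u) ^ γ / (r - u) ^ (α + 1) ≤
      2 ^ γ / (γ - α) * (r - s) ^ (γ - α) * cellOffset (n * r) ^ (-γ) := by
  have hA := cellOffset_pos (n * r)
  have hp : -1 < γ - α - 1 := by linarith
  have hint : IntervalIntegrable (fun u => (r - u) ^ (γ - α - 1)) volume s r := by
    simpa using (intervalIntegrable_rpow' hp (a := r - s) (b := 0)).comp_sub_left r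
  calc
    _ ≤ ∫ u in s..r, (2 / cellOffset (n * r)) ^ γ * (r - u) ^ (γ - α - 1) := by
      refine intervalIntegral_mono_of_nonneg hsr (hint.const_mul _) (fun u hu => ?_) fun u hu => ?_
      · exact div_nonneg (Real.rpow_nonneg (sub_nonneg.2 (ceilG_mono n hu.2.le)) _)
          (Real.rpow_nonneg (sub_nonneg.2 hu.2.le) _)
      · have hpos : 0 < r - u := sub_pos.2 hu.2
        have h0 := sub_nonneg.2 (ceilG_mono n hu.2.le)
        rw [sub_sub, Real.rpow_sub hpos, ← mul_div_assoc, ← Real.mul_rpow (by positivity) hpos.le]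
        have := ceilG_sub_le hn hu.2.le
        gcongr
    _ = _ := by
      rw [intervalIntegral.integral_const_mul,
        intervalIntegral.integral_comp_sub_left (fun x => x ^ (γ - α - 1)), sub_self,
        integral_rpow (Or.inl hp), sub_add_cancel, Real.zero_rpow (sub_pos.2 hαγ).ne', sub_zero,
        Real.div_rpow zero_le_two hA.le, Real.rpow_neg hA.le]
      field_simp

/-- Within a single grid cell there are no grid increments. -/
theorem integral_ceilG_sub_rpow_div_eq_zero {p q : ℝ} (hq : q ≠ 0) {n : ℕ} {s r : ℝ} (hsr : s ≤ r)
    (h : ∀ u ∈ Ioc s r, ceilG n u = ceilG n r) :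
    ∫ u in s..r, (ceilG n r - ceilG n u) ^ q / (r - u) ^ p = 0 := by
  rw [intervalIntegral.integral_congr_Ioo_of_le (g := fun _ => 0) hsr, intervalIntegral.integral_zero]
  intro u hu
  simp [h u (Ioo_subset_Ioc_self hu), Real.zero_rpow hq]

theorem ceilG_eq_of_mem_cell {n : ℕ} (hn : 0 < n) {s r : ℝ} (hs : s = ceilG n s) (hsr : s < r)
    (hr : n * (r - s) ≤ 1) : ceilG n r = s + 1 / n := by
  have hn' : (0 : ℝ) < n := by exact_mod_cast hn
  have hns : (n : ℝ) * s = ⌈(n : ℝ) * s⌉ := by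
    rw [ceilG, eq_div_iff hn'.ne'] at hs
    rwa [mul_comm (n : ℝ) s] at hs ⊢
  have hc : ⌈(n : ℝ) * r⌉ = ⌈(n : ℝ) * s⌉ + 1 := by
    rw [Int.ceil_eq_iff]
    push_cast
    rw [← hns]
    constructor <;> nlinarith
  rw [ceilG, hc]
  push_cast
  rw [← hns]
  field_simp

/-- **Fractional-calculus kernel estimate with right grid projections.**
Fix `T = 1` and `n ∈ ℕ₊`. If `β' > α > 1 - β` (with `α, β, β' ∈ (0,1)`), then there is a
constant `C = C(α, β, β')` independent of `n` such that for every grid point `s` and every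
`t ∈ (s, 1]`,
`∫_s^t (t-r)^{α+β-1} ∫_s^r (⌈r⌉ⁿ - ⌈u⌉ⁿ)^{β'} / (r-u)^{α+1} du dr ≤ C (t-s)^{β+β'}`. -/
theorem kernel_estimate_ceil (α β β' : ℝ)
    (hα : α ∈ Set.Ioo (0:ℝ) 1) (hβ : β ∈ Set.Ioo (0:ℝ) 1) (hβ' : β' ∈ Set.Ioo (0:ℝ) 1)
    (h1 : β' > α) (h2 : α > 1 - β) :
    ∃ C : ℝ, 0 < C ∧ ∀ (n : ℕ), 0 < n → ∀ s t : ℝ, 0 ≤ s → s = ceilG n s →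
      s < t → t ≤ 1 →
      (∫ r in s..t, (t - r) ^ (α + β - 1) *
          ∫ u in s..r, (ceilG n r - ceilG n u) ^ β' / (r - u) ^ (α + 1)) ≤
        C * (t - s) ^ (β + β') := by
  obtain ⟨hα0, hα1⟩ := hα
  obtain ⟨hβ0, hβ1⟩ := hβ
  obtain ⟨hγ0, hγ1⟩ := hβ'
  have hd : 0 < β' - α := sub_pos.2 h1
  have he : 0 < 1 - β' := sub_pos.2 hγ1
  refine ⟨2 ^ β' / (β' - α) * (2 / (1 - β')), by positivity, ?_⟩
  intro n hn s t _ hs hst _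
  have hn' : (0 : ℝ) < n := by exact_mod_cast hn
  have hts : 0 < t - s := sub_pos.2 hst
  rcases le_or_gt (n * (t - s)) 1 with hcell | hcell
  · rw [intervalIntegral.integral_congr_Ioo_of_le (g := fun _ => 0) hst.le, intervalIntegral.integral_zero]
    · positivity
    intro r hr
    have hmem : ∀ u ∈ Ioc s t, ceilG n u = s + 1 / n := fun u hu =>
      ceilG_eq_of_mem_cell hn hs hu.1
        ((mul_le_mul_of_nonneg_left (sub_le_sub_right hu.2 s) hn'.le).trans hcell)
    have hzero := integral_ceilG_sub_rpow_div_eq_zero (p := α + 1) hγ0.ne' hr.1.le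
      fun u hu => (hmem u ⟨hu.1, hu.2.trans hr.2.le⟩).trans (hmem r (Ioo_subset_Ioc_self hr)).symm
    simp only [hzero, mul_zero]
  have hp : -1 < -β' := by linarith
  set K := (t - s) ^ (α + β - 1) * (2 ^ β' / (β' - α) * (t - s) ^ (β' - α)) with hK
  have hK0 : 0 ≤ K := by positivity
  have hint : IntervalIntegrable (fun r => cellOffset (n * r) ^ (-β')) volume s t := by
    have := (intervalIntegrable_cellOffset_rpow hp (n * s) (n * t)).comp_mul_left (c := (n : ℝ))
    simpa [hn'.ne'] using this
  calc
    _ ≤ ∫ r in s..t, K * cellOffset (n * r) ^ (-β') := by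
      refine intervalIntegral_mono_of_nonneg hst.le (hint.const_mul K)
        (fun r hr => ?_) fun r hr => ?_
      · exact mul_nonneg (Real.rpow_nonneg (sub_nonneg.2 hr.2.le) _)
          (integral_ceilG_sub_rpow_div_nonneg n hr.1.le)
      · have hA := cellOffset_pos (n * r)
        have hrs : 0 ≤ r - s := sub_nonneg.2 hr.1.le
        have htr : 0 ≤ t - r := sub_nonneg.2 hr.2.le
        refine (mul_le_mul_of_nonneg_left
          (integral_ceilG_sub_rpow_div_le hγ0.le h1 hn hr.1.le) (by positivity)).trans ?_
        rw [hK, mul_assoc ((t - s) ^ (α + β - 1))]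
        have hexp : 0 ≤ α + β - 1 := by linarith
        have h3 := hr.1.le
        have h4 := hr.2.le
        gcongr
    _ = K * ((n : ℝ)⁻¹ * ∫ x in n * s..n * t, cellOffset x ^ (-β')) := by
      rw [intervalIntegral.integral_const_mul,
        intervalIntegral.integral_comp_mul_left (fun x => cellOffset x ^ (-β')) hn'.ne',
        smul_eq_mul]
    _ ≤ K * ((n : ℝ)⁻¹ * ((n * t - n * s + 1) / (-β' + 1))) := by
      gcongr
      exact integral_cellOffset_rpow_le hp (by gcongr)
    _ ≤ K * ((n : ℝ)⁻¹ * (2 * (n * (t - s)) / (1 - β'))) := by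
      rw [neg_add_eq_sub]
      gcongr
      linarith
    _ = 2 ^ β' / (β' - α) * (2 / (1 - β')) *
        ((t - s) ^ (α + β - 1) * (t - s) ^ (β' - α) * (t - s) ^ (1 : ℝ)) := by
      rw [hK, Real.rpow_one]
      field_simp
    _ = _ := by
      rw [← Real.rpow_add hts, ← Real.rpow_add hts]
      ring_nf
end

section
/- Let $1/2<\alpha<1$, and let $f:[s,t]\to\mathbb{R}$ be $\beta$-Hölder continuous with $\beta>1-\alpha$. Let $g$ be a step function on $[s,t]$ adapted to a partition $s=t_0<\dots<t_n=t$, i.e. $g_r=g^k$ for $r\in(t_k,t_{k+1}]$. Then the Riemann–Stieltjes sum $\sum_{k=0}^{n-1} g^k(f_{t_{k+1}}-f_{t_k})$ equals the fractional-integral expression $(-1)^\alpha\int_s^t (D^\alpha_{s+}g)_r\,(D^{1-\alpha}_{t-}F)_r\,dr$, where $F_r=f_r-f_t$. -/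
open intervalIntegral Real

/-- Left Weyl fractional derivative
`(D^α_{s+} g)_r = (1/Γ(1-α)) (g_r/(r-s)^α + α ∫_s^r (g_r - g_u)/(r-u)^{α+1} du)`. -/
noncomputable def weylLeft (g : ℝ → ℝ) (s α : ℝ) (r : ℝ) : ℝ :=
  (1 / Real.Gamma (1 - α)) *
    (g r / (r - s) ^ α + α * ∫ u in s..r, (g r - g u) / (r - u) ^ (α + 1))

/-- Right Weyl fractional derivative (of order `1-α`, complex-valued, with the factor
`(-1)^{1-α} = e^{-iπ(1-α)}`):
`(D^{1-α}_{t-} F)_r = ((-1)^{1-α}/Γ(α)) (F_r/(t-r)^{1-α} + (1-α) ∫_r^t (F_r-F_u)/(u-r)^{2-α} du)`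
where `F_r = f_r - f_t`. -/
noncomputable def weylRight (f : ℝ → ℝ) (t α : ℝ) (r : ℝ) : ℂ :=
  (Complex.exp (-(Real.pi * (1 - α)) * Complex.I) / (Real.Gamma α : ℂ)) *
    (((f r - f t) / (t - r) ^ (1 - α) +
      (1 - α) * ∫ u in r..t, ((f r - f t) - (f u - f t)) / (u - r) ^ (2 - α) : ℝ) : ℂ)

open MeasureTheory Set Filter Topology

theorem intervalIntegrable_rpow_neg_mul_rpow_sub {α T : ℝ} (hα0 : 0 < α) (hα1 : α < 1)
    (hT : 0 < T) :
    IntervalIntegrable (fun x : ℝ => x ^ (-α) * (T - x) ^ (α - 1)) volume 0 T ∧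
      ∫ x in (0 : ℝ)..T, x ^ (-α) * (T - x) ^ (α - 1) = Gamma (1 - α) * Gamma α := by
  have hint : ∫ x in (0 : ℝ)..T, x ^ (-α) * (T - x) ^ (α - 1) = Gamma (1 - α) * Gamma α := by
    have hscale := Complex.betaIntegral_scaled ((1 - α : ℝ) : ℂ) (α : ℂ) hT
    have hbeta := Complex.Gamma_mul_Gamma_eq_betaIntegral (s := ((1 - α : ℝ) : ℂ)) (t := (α : ℂ))
      (by simpa using hα1) (by simpa using hα0)
    have hsum : ((1 - α : ℝ) : ℂ) + (α : ℂ) = 1 := by push_cast; ring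
    rw [hsum, Complex.Gamma_one, one_mul] at hbeta
    rw [hsum, sub_self, Complex.cpow_zero, one_mul, ← hbeta, Complex.Gamma_ofReal,
      Complex.Gamma_ofReal] at hscale
    rw [← Complex.ofReal_inj, ← intervalIntegral.integral_ofReal]
    push_cast
    rw [← hscale]
    refine intervalIntegral.integral_congr fun x hx => ?_
    rw [uIcc_of_le hT.le] at hx
    rw [Complex.ofReal_cpow hx.1, Complex.ofReal_cpow (sub_nonneg.2 hx.2)]
    push_cast
    ring_nf
  refine ⟨?_, hint⟩
  by_contra hcon
  rw [intervalIntegral.integral_undef hcon] at hint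
  exact (mul_pos (Gamma_pos_of_pos (sub_pos.2 hα1)) (Gamma_pos_of_pos hα0)).ne hint

theorem integrableOn_Ioi_sub_rpow {p x T : ℝ} (hp : p < -1) (hx : x < T) :
    IntegrableOn (fun y : ℝ => (y - x) ^ p) (Ioi T) ∧
      ∫ y in Ioi T, (y - x) ^ p = (T - x) ^ (p + 1) / (-(p + 1)) := by
  have hi : IntegrableOn (fun y : ℝ => (y - x) ^ p) (Ioi T) := by
    simpa [sub_eq_add_neg] using
      integrableOn_add_rpow_Ioi_of_lt (a := p) (c := T) (m := -x) hp (by simpa using hx)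
  refine ⟨hi, ?_⟩
  have hne : p + 1 ≠ 0 := by linarith
  have hderiv : ∀ y ∈ Ici T, HasDerivAt (fun y : ℝ => (y - x) ^ (p + 1) / (p + 1))
      ((y - x) ^ p) y := by
    intro y hy
    have hpos : y - x ≠ 0 := by have : T ≤ y := hy; linarith
    refine ((((hasDerivAt_id y).sub_const x).rpow_const (p := p + 1) (Or.inl hpos)).div_const
      (p + 1)).congr_deriv ?_
    rw [add_sub_cancel_right]
    field_simp
    simp
  have hlim : Tendsto (fun y : ℝ => (y - x) ^ (p + 1) / (p + 1)) atTop (𝓝 (0 / (p + 1))) := by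
    refine Tendsto.div_const ?_ _
    have := (tendsto_rpow_neg_atTop (y := -(p + 1)) (by linarith)).comp
      (tendsto_atTop_add_const_right atTop (-x) tendsto_id)
    simpa [Function.comp_def, sub_eq_add_neg] using this
  rw [integral_Ioi_of_hasDerivAt_of_tendsto' hderiv hi hlim]
  field_simp
  ring

theorem integrableOn_Ioc_sub_rpow {p x T : ℝ} (hp : -1 < p) (hx : x < T) :
    IntegrableOn (fun y : ℝ => (y - x) ^ p) (Ioc x T) ∧
      ∫ y in Ioc x T, (y - x) ^ p = (T - x) ^ (p + 1) / (p + 1) := by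
  constructor
  · rw [← intervalIntegrable_iff_integrableOn_Ioc_of_le hx.le]
    have := (intervalIntegral.intervalIntegrable_rpow' (a := 0) (b := T - x) hp).comp_sub_right x
    simpa using this
  · rw [← intervalIntegral.integral_of_le hx.le,
      intervalIntegral.integral_comp_sub_right (fun y => y ^ p), sub_self,
      integral_rpow (Or.inl hp), zero_rpow (by linarith), sub_zero]

section Core

variable {α β T C : ℝ} {h : ℝ → ℝ}

theorem holder_increment_tail (hα1 : α < 1) (hT : ∀ x, T ≤ x → h x = 0) {x : ℝ} (hx : x < T) :
    IntegrableOn (fun y => (h x - h y) * (y - x) ^ (α - 2)) (Ioi T) ∧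
      (∫ y in Ioi T, (h x - h y) * (y - x) ^ (α - 2) = h x * ((T - x) ^ (α - 1) / (1 - α))) ∧
      ∫ y in Ioi T, ‖(h x - h y) * (y - x) ^ (α - 2)‖ =
        |h x| * ((T - x) ^ (α - 1) / (1 - α)) := by
  obtain ⟨hi, hv⟩ := integrableOn_Ioi_sub_rpow (p := α - 2) (by linarith) hx
  have hpow : (T - x) ^ (α - 2 + 1) / (-(α - 2 + 1)) = (T - x) ^ (α - 1) / (1 - α) := by
    ring_nf
  have hEq : EqOn (fun y => h x * (y - x) ^ (α - 2))
      (fun y => (h x - h y) * (y - x) ^ (α - 2)) (Ioi T) := by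
    intro y hy
    simp [hT y (le_of_lt hy)]
  refine ⟨IntegrableOn.congr_fun (hi.const_mul (h x)) hEq measurableSet_Ioi, ?_, ?_⟩
  · rw [← setIntegral_congr_fun measurableSet_Ioi hEq, MeasureTheory.integral_const_mul, hv, hpow]
  · rw [← hpow, ← hv, ← MeasureTheory.integral_const_mul]
    refine setIntegral_congr_fun measurableSet_Ioi fun y hy => ?_
    have hxy : 0 < y - x := by have : T < y := hy; linarith
    simp [hT y (le_of_lt hy), abs_of_nonneg (rpow_nonneg hxy.le (α - 2))]

theorem holder_increment_near (hβ : 1 - α < β) (hm : Measurable h)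
    (hd : ∀ x y, 0 < x → x < y → y < T → |h x - h y| ≤ C * (y - x) ^ β)
    {x : ℝ} (hx0 : 0 < x) (hx : x < T) :
    IntegrableOn (fun y => (h x - h y) * (y - x) ^ (α - 2)) (Ioc x T) ∧
      ∫ y in Ioc x T, ‖(h x - h y) * (y - x) ^ (α - 2)‖ ≤
        C * ((T - x) ^ (α + β - 1) / (α + β - 1)) := by
  obtain ⟨hi, hv⟩ := integrableOn_Ioc_sub_rpow (p := α + β - 2) (by linarith) hx
  have hbound : ∀ᵐ y ∂(volume.restrict (Ioc x T)),
      ‖(h x - h y) * (y - x) ^ (α - 2)‖ ≤ C * (y - x) ^ (α + β - 2) := by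
    rw [ae_restrict_iff' measurableSet_Ioc]
    filter_upwards [Measure.ae_ne volume T] with y hyT hy
    have hxy : 0 < y - x := sub_pos.2 hy.1
    rw [norm_mul, norm_eq_abs, norm_eq_abs, abs_of_nonneg (rpow_nonneg hxy.le _),
      show α + β - 2 = β + (α - 2) by ring, rpow_add hxy, ← mul_assoc]
    exact mul_le_mul_of_nonneg_right (hd x y hx0 hy.1 (lt_of_le_of_ne hy.2 hyT))
      (rpow_nonneg hxy.le _)
  have hI : IntegrableOn (fun y => (h x - h y) * (y - x) ^ (α - 2)) (Ioc x T) := by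
    refine Integrable.mono' (hi.const_mul C) ?_ hbound
    exact Measurable.aestronglyMeasurable (by fun_prop)
  refine ⟨hI, (integral_mono_ae hI.norm (hi.const_mul C) hbound).trans_eq ?_⟩
  rw [MeasureTheory.integral_const_mul, hv]
  ring_nf

theorem holder_increment_integrableOn (hα1 : α < 1) (hβ : 1 - α < β) (hm : Measurable h)
    (hT : ∀ x, T ≤ x → h x = 0)
    (hd : ∀ x y, 0 < x → x < y → y < T → |h x - h y| ≤ C * (y - x) ^ β)
    {x : ℝ} (hx0 : 0 < x) (hx : x < T) :
    IntegrableOn (fun y => (h x - h y) * (y - x) ^ (α - 2)) (Ioi x) ∧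
      ∫ y in Ioi x, ‖(h x - h y) * (y - x) ^ (α - 2)‖ ≤
        C * ((T - x) ^ (α + β - 1) / (α + β - 1)) + |h x| * ((T - x) ^ (α - 1) / (1 - α)) := by
  obtain ⟨hn, hnv⟩ := holder_increment_near hβ hm hd hx0 hx
  obtain ⟨ht, -, htv⟩ := holder_increment_tail hα1 hT hx
  rw [← Ioc_union_Ioi_eq_Ioi hx.le]
  refine ⟨hn.union ht, ?_⟩
  rw [setIntegral_union (Ioc_disjoint_Ioi le_rfl) measurableSet_Ioi hn.norm ht.norm, htv]
  gcongr

theorem setIntegral_scaled_increment (F : ℝ → ℝ) {x : ℝ} (hx : 0 < x) (h : ℝ → ℝ)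
    (hF : ∀ c y : ℝ, 0 ≤ c → F (c * y) = c * F y) :
    ∫ w in Ioi (1 : ℝ), F (x⁻¹ * ((h x - h (x * w)) * (w - 1) ^ (α - 2))) =
      x ^ (-α) * ∫ y in Ioi x, F ((h x - h y) * (y - x) ^ (α - 2)) := by
  have hcv := integral_comp_mul_left_Ioi' (fun y => F ((h x - h y) * (y - x) ^ (α - 2))) 1 hx
  rw [mul_one, smul_eq_mul] at hcv
  rw [← hcv, ← mul_assoc, ← MeasureTheory.integral_const_mul]
  refine setIntegral_congr_fun measurableSet_Ioi fun w hw => ?_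
  have hw1 : 0 ≤ w - 1 := by have : 1 < w := hw; linarith
  have hfac : x * w - x = x * (w - 1) := by ring
  have hcoef : x ^ (-α) * x * x ^ (α - 2) = x⁻¹ := by
    nth_rewrite 2 [← rpow_one x]
    rw [← rpow_add hx, ← rpow_add hx, ← rpow_neg_one]
    ring_nf
  rw [hfac, mul_rpow hx.le hw1, ← hF _ _ (by positivity), ← hcoef]
  ring_nf

theorem integrableOn_div_of_holder_at_zero (hβ0 : 0 < β) (hm : Measurable h)
    (hT0 : 0 < T) (hT : ∀ x, T ≤ x → h x = 0)
    (h0 : ∀ x, 0 < x → x < T → |h x| ≤ C * x ^ β) :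
    IntegrableOn (fun x => x⁻¹ * h x) (Ioi 0) := by
  rw [← Ioo_union_Ici_eq_Ioi hT0]
  refine IntegrableOn.union ?_ ?_
  · have hi : IntegrableOn (fun x : ℝ => x ^ (β - 1)) (Ioo 0 T) :=
      (intervalIntegral.integrableOn_Ioo_rpow_iff hT0).2 (by linarith)
    refine Integrable.mono' (hi.const_mul C)
      (Measurable.aestronglyMeasurable (by fun_prop)) ?_
    rw [ae_restrict_iff' measurableSet_Ioo]
    refine Eventually.of_forall fun x hx => ?_
    rw [norm_mul, norm_inv, norm_eq_abs, norm_eq_abs, abs_of_pos hx.1, rpow_sub_one hx.1.ne']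
    have := mul_le_mul_of_nonneg_left (h0 x hx.1 hx.2) (inv_pos.2 hx.1).le
    rwa [div_eq_inv_mul, mul_left_comm]
  · refine IntegrableOn.congr_fun integrableOn_zero (fun x hx => ?_) measurableSet_Ici
    simp [hT x hx]

theorem integrable_scaled_increment (hα0 : 0 < α) (hα1 : α < 1) (hβ : 1 - α < β)
    (hm : Measurable h) (hT0 : 0 < T) (hT : ∀ x, T ≤ x → h x = 0)
    (h0 : ∀ x, 0 < x → x < T → |h x| ≤ C * x ^ β)
    (hd : ∀ x y, 0 < x → x < y → y < T → |h x - h y| ≤ C * (y - x) ^ β) :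
    Integrable (Function.uncurry fun x w => x⁻¹ * ((h x - h (x * w)) * (w - 1) ^ (α - 2)))
      ((volume.restrict (Ioi 0)).prod (volume.restrict (Ioi 1))) := by
  have hmeas : AEStronglyMeasurable
      (Function.uncurry fun x w => x⁻¹ * ((h x - h (x * w)) * (w - 1) ^ (α - 2)))
      ((volume.restrict (Ioi 0)).prod (volume.restrict (Ioi 1))) := by
    refine Measurable.aestronglyMeasurable ?_
    unfold Function.uncurry
    fun_prop
  have hzero : ∀ x w : ℝ, T ≤ x → 1 < w →
      x⁻¹ * ((h x - h (x * w)) * (w - 1) ^ (α - 2)) = 0 := by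
    intro x w hx hw
    have hxw : T ≤ x * w := by nlinarith
    simp [hT x hx, hT _ hxw]
  have hC : 0 ≤ C := by
    have := (abs_nonneg _).trans (h0 (T / 2) (by linarith) (by linarith))
    exact nonneg_of_mul_nonneg_left this (rpow_pos_of_pos (by linarith) β)
  rw [integrable_prod_iff hmeas]
  constructor
  · rw [ae_restrict_iff' measurableSet_Ioi]
    refine Eventually.of_forall fun x hx => ?_
    have hx0 : 0 < x := hx
    rcases lt_or_ge x T with hxT | hxT
    · have hi := (holder_increment_integrableOn hα1 hβ hm hT hd hx0 hxT).1
      have := (integrableOn_Ioi_comp_mul_left_iff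
        (fun y => (h x - h y) * (y - x) ^ (α - 2)) 1 hx0).2 (by simpa using hi)
      refine IntegrableOn.congr_fun (this.const_mul (x⁻¹ * (x ^ (α - 2))⁻¹)) (fun w hw => ?_)
        measurableSet_Ioi
      have hw1 : 0 ≤ w - 1 := by have : 1 < w := hw; linarith
      have hpos : x ^ (α - 2) ≠ 0 := (rpow_pos_of_pos hx0 _).ne'
      simp only [Function.uncurry]
      rw [show x * w - x = x * (w - 1) by ring, mul_rpow hx0.le hw1]
      field_simp
    · refine IntegrableOn.congr_fun integrableOn_zero (fun w hw => ?_) measurableSet_Ioi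
      exact (hzero x w hxT hw).symm
  · have hmono := hmeas.norm.integral_prod_right'
    change IntegrableOn _ (Ioi 0) volume
    rw [← Ioo_union_Ici_eq_Ioi hT0]
    refine IntegrableOn.union ?_ ?_
    · have hb : IntegrableOn (fun x : ℝ => x ^ (-α) * (T - x) ^ (α - 1)) (Ioo 0 T) :=
        ((intervalIntegrable_iff_integrableOn_Ioo_of_le hT0.le).1
          (intervalIntegrable_rpow_neg_mul_rpow_sub hα0 hα1 hT0).1)
      refine Integrable.mono' (hb.const_mul (C * T ^ β * (1 / (α + β - 1) + 1 / (1 - α))))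
        (hmono.mono_measure (Measure.restrict_mono Ioo_subset_Ioi_self le_rfl)) ?_
      rw [ae_restrict_iff' measurableSet_Ioo]
      refine Eventually.of_forall fun x hx => ?_
      have hxT : 0 < T - x := sub_pos.2 hx.2
      rw [norm_of_nonneg (integral_nonneg fun w => norm_nonneg _)]
      simp only [Function.uncurry]
      rw [setIntegral_scaled_increment (fun y => ‖y‖) hx.1 h
        (fun c y hc => by rw [norm_mul, norm_of_nonneg hc])]
      have hv := (holder_increment_integrableOn hα1 hβ hm hT hd hx.1 hx.2).2
      have e1 : (T - x) ^ (α + β - 1) ≤ T ^ β * (T - x) ^ (α - 1) := by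
        rw [show α + β - 1 = β + (α - 1) by ring, rpow_add hxT]
        gcongr
        · linarith
        · linarith [hx.1]
      have e2 : |h x| ≤ C * T ^ β := by
        refine (h0 x hx.1 hx.2).trans ?_
        gcongr
        · exact hx.1.le
        · linarith
        · exact hx.2.le
      have p1 : 0 < α + β - 1 := by linarith
      have p2 : 0 < 1 - α := by linarith
      have px : 0 ≤ x ^ (-α) := rpow_nonneg hx.1.le _
      calc x ^ (-α) * ∫ y in Ioi x, ‖(h x - h y) * (y - x) ^ (α - 2)‖
          ≤ x ^ (-α) * (C * (T ^ β * (T - x) ^ (α - 1) / (α + β - 1)) +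
              C * T ^ β * ((T - x) ^ (α - 1) / (1 - α))) := by
            refine mul_le_mul_of_nonneg_left (hv.trans ?_) px
            have q : 0 ≤ (T - x) ^ (α - 1) := rpow_nonneg hxT.le _
            gcongr
        _ = _ := by ring
    · refine IntegrableOn.congr_fun integrableOn_zero (fun x hx => ?_) measurableSet_Ici
      simp only [Function.uncurry]
      rw [setIntegral_congr_fun (g := fun _ => (0 : ℝ)) measurableSet_Ioi
        (fun w hw => by simp only [hzero x w hx hw, norm_zero])]
      simp

theorem integral_rpow_mul_holder_increment_eq_zero (hα0 : 0 < α) (hα1 : α < 1) (hβ : 1 - α < β)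
    (hm : Measurable h) (hT0 : 0 < T) (hT : ∀ x, T ≤ x → h x = 0)
    (h0 : ∀ x, 0 < x → x < T → |h x| ≤ C * x ^ β)
    (hd : ∀ x y, 0 < x → x < y → y < T → |h x - h y| ≤ C * (y - x) ^ β) :
    IntegrableOn (fun x => x ^ (-α) * ∫ y in Ioi x, (h x - h y) * (y - x) ^ (α - 2)) (Ioc 0 T) ∧
      ∫ x in Ioc 0 T, x ^ (-α) * ∫ y in Ioi x, (h x - h y) * (y - x) ^ (α - 2) = 0 := by
  have hint := integrable_scaled_increment hα0 hα1 hβ hm hT0 hT h0 hd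
  have hEq : EqOn (fun x => ∫ w in Ioi (1 : ℝ), x⁻¹ * ((h x - h (x * w)) * (w - 1) ^ (α - 2)))
      (fun x => x ^ (-α) * ∫ y in Ioi x, (h x - h y) * (y - x) ^ (α - 2)) (Ioi 0) :=
    fun x hx => setIntegral_scaled_increment (fun y => y) hx h (fun _ _ _ => rfl)
  have hfull : IntegrableOn
      (fun x => x ^ (-α) * ∫ y in Ioi x, (h x - h y) * (y - x) ^ (α - 2)) (Ioi 0) :=
    IntegrableOn.congr_fun hint.integral_prod_left hEq measurableSet_Ioi
  refine ⟨hfull.mono_set Ioc_subset_Ioi_self, ?_⟩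
  rw [setIntegral_eq_of_subset_of_forall_sdiff_eq_zero (t := Ioi 0) measurableSet_Ioi
    Ioc_subset_Ioi_self ?_ |>.symm, ← setIntegral_congr_fun measurableSet_Ioi hEq,
    integral_integral_swap hint]
  · rw [setIntegral_congr_fun (g := fun _ => (0 : ℝ)) measurableSet_Ioi, integral_zero]
    intro w hw
    have hw0 : 0 < w := lt_trans one_pos hw
    have hdiv := integrableOn_div_of_holder_at_zero (by linarith : 0 < β) hm hT0 hT h0
    have hdivw : IntegrableOn (fun x => (x * w)⁻¹ * h (x * w)) (Ioi 0) := by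
      have := (integrableOn_Ioi_comp_mul_right_iff (fun x => x⁻¹ * h x) 0 hw0).2
        (by simpa using hdiv)
      exact this
    have hval : w * ∫ x in Ioi 0, (x * w)⁻¹ * h (x * w) = ∫ x in Ioi 0, x⁻¹ * h x := by
      simpa using integral_comp_mul_right_Ioi' (fun x => x⁻¹ * h x) 0 hw0
    calc ∫ x in Ioi 0, x⁻¹ * ((h x - h (x * w)) * (w - 1) ^ (α - 2))
        = ∫ x in Ioi 0, (w - 1) ^ (α - 2) *
            (x⁻¹ * h x - w * ((x * w)⁻¹ * h (x * w))) := by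
          refine setIntegral_congr_fun measurableSet_Ioi fun x hx => ?_
          have hx0 : x ≠ 0 := (show (0 : ℝ) < x from hx).ne'
          field_simp
      _ = 0 := by
          rw [MeasureTheory.integral_const_mul, MeasureTheory.integral_sub hdiv (hdivw.const_mul w),
            MeasureTheory.integral_const_mul, hval, sub_self, mul_zero]
  · intro x hx
    have hxT : T < x := by
      by_contra hcon
      exact hx.2 ⟨hx.1, not_lt.1 hcon⟩
    rw [setIntegral_congr_fun (g := fun _ => (0 : ℝ)) measurableSet_Ioi]
    · simp
    · intro y hy
      simp [hT x hxT.le, hT y (hxT.trans hy).le]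

end Core

theorem continuousOn_of_abs_sub_le_rpow {f : ℝ → ℝ} {S : Set ℝ} {C β : ℝ} (hβ : 0 < β)
    (hf : ∀ u v, u ∈ S → v ∈ S → |f v - f u| ≤ C * |v - u| ^ β) : ContinuousOn f S := by
  intro u hu
  rw [ContinuousWithinAt, tendsto_iff_dist_tendsto_zero]
  have hlim : Tendsto (fun v => C * |v - u| ^ β) (𝓝[S] u) (𝓝 0) := by
    have hc : Continuous fun v : ℝ => C * |v - u| ^ β :=
      continuous_const.mul ((continuous_id.sub continuous_const).abs.rpow_const
        fun _ => Or.inr hβ.le)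
    have := hc.tendsto u
    simp only [sub_self, abs_zero, zero_rpow hβ.ne', mul_zero] at this
    exact this.mono_left nhdsWithin_le_nhds
  refine squeeze_zero' (Eventually.of_forall fun _ => dist_nonneg) ?_ hlim
  filter_upwards [self_mem_nhdsWithin] with v hv
  exact hf u v hu hv

/-- The real factor of `weylRight`. -/
noncomputable def weylRightReal (f : ℝ → ℝ) (t α r : ℝ) : ℝ :=
  (f r - f t) / (t - r) ^ (1 - α) +
    (1 - α) * ∫ u in r..t, ((f r - f t) - (f u - f t)) / (u - r) ^ (2 - α)

theorem weylRightReal_add {α a T : ℝ} {f h : ℝ → ℝ} (hα1 : α < 1)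
    (hT : ∀ x, T ≤ x → h x = 0) (hh : ∀ x, 0 < x → x < T → h x = f (a + x) - f a)
    {x : ℝ} (hx : x ∈ Ioo 0 T)
    (hi : IntegrableOn (fun y => (h x - h y) * (y - x) ^ (α - 2)) (Ioi x)) :
    weylRightReal f (a + T) α (a + x) =
      -(f (a + T) - f a) * (T - x) ^ (α - 1) +
        (1 - α) * ∫ y in Ioi x, (h x - h y) * (y - x) ^ (α - 2) := by
  have hTx : 0 < T - x := sub_pos.2 hx.2
  have hshift : ∫ u in (a + x)..(a + T),
      ((f (a + x) - f (a + T)) - (f u - f (a + T))) / (u - (a + x)) ^ (2 - α) =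
      ∫ y in Ioc x T, (h x - h y) * (y - x) ^ (α - 2) := by
    rw [← intervalIntegral.integral_comp_add_left
      (fun u => ((f (a + x) - f (a + T)) - (f u - f (a + T))) / (u - (a + x)) ^ (2 - α)),
      intervalIntegral.integral_of_le hx.2.le, integral_Ioc_eq_integral_Ioo,
      integral_Ioc_eq_integral_Ioo]
    refine setIntegral_congr_fun measurableSet_Ioo fun y hy => ?_
    have hyx : 0 ≤ y - x := (sub_pos.2 hy.1).le
    rw [hh x hx.1 hx.2, hh y (hx.1.trans hy.1) hy.2, show α - 2 = -(2 - α) by ring,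
      rpow_neg hyx, div_eq_mul_inv, show a + y - (a + x) = y - x by ring]
    ring
  have hsplit : ∫ y in Ioi x, (h x - h y) * (y - x) ^ (α - 2) =
      (∫ y in Ioc x T, (h x - h y) * (y - x) ^ (α - 2)) +
        h x * ((T - x) ^ (α - 1) / (1 - α)) := by
    rw [← (holder_increment_tail hα1 hT hx.2).2.1,
      ← setIntegral_union (Ioc_disjoint_Ioi le_rfl) measurableSet_Ioi
        (hi.mono_set Ioc_subset_Ioi_self) (hi.mono_set (Ioi_subset_Ioi hx.2.le)),
      Ioc_union_Ioi_eq_Ioi hx.2.le]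
  rw [weylRightReal, hshift, hsplit, hh x hx.1 hx.2, show a + T - (a + x) = T - x by ring,
    div_eq_mul_inv (f (a + x) - f (a + T)), ← rpow_neg hTx.le, neg_sub, mul_add,
    mul_left_comm (1 - α) (f (a + x) - f a), mul_div_cancel₀ _ (sub_pos.2 hα1).ne']
  ring

theorem integral_rpow_mul_weylRightReal {α β a t C : ℝ} {f : ℝ → ℝ} (hα0 : 0 < α) (hα1 : α < 1)
    (hβ : 1 - α < β) (hat : a < t)
    (hf : ∀ u v, u ∈ Icc a t → v ∈ Icc a t → |f v - f u| ≤ C * |v - u| ^ β) :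
    IntervalIntegrable (fun r => (r - a) ^ (-α) * weylRightReal f t α r) volume a t ∧
      ∫ r in a..t, (r - a) ^ (-α) * weylRightReal f t α r =
        -(f t - f a) * (Gamma (1 - α) * Gamma α) := by
  obtain ⟨T, rfl⟩ : ∃ T, t = a + T := ⟨t - a, by ring⟩
  have hT0 : 0 < T := by linarith
  have hcont : Continuous fun x => f (max a (min (a + T) (a + x))) - f a :=
    ((continuousOn_of_abs_sub_le_rpow (by linarith) hf).comp_continuous (by fun_prop)
      fun x => ⟨le_max_left _ _, max_le hat.le (min_le_left _ _)⟩).sub continuous_const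
  set h : ℝ → ℝ := (Iio T).indicator fun x => f (max a (min (a + T) (a + x))) - f a with hdef
  have hm : Measurable h := hcont.measurable.indicator measurableSet_Iio
  have hT : ∀ x, T ≤ x → h x = 0 := fun x hx => indicator_of_notMem (s := Iio T) (not_lt.2 hx) _
  have hh : ∀ x, 0 < x → x < T → h x = f (a + x) - f a := by
    intro x hx0 hxT
    rw [hdef, indicator_of_mem (show x ∈ Iio T from hxT), min_eq_right (by linarith),
      max_eq_right (by linarith)]
  have h0 : ∀ x, 0 < x → x < T → |h x| ≤ C * x ^ β := by
    intro x hx0 hxT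
    rw [hh x hx0 hxT]
    simpa [abs_of_pos hx0] using
      hf a (a + x) ⟨le_rfl, hat.le⟩ ⟨by linarith, by linarith⟩
  have hd : ∀ x y, 0 < x → x < y → y < T → |h x - h y| ≤ C * (y - x) ^ β := by
    intro x y hx0 hxy hyT
    rw [hh x hx0 (hxy.trans hyT), hh y (hx0.trans hxy) hyT, abs_sub_comm]
    simpa [abs_of_pos (sub_pos.2 hxy)] using
      hf (a + x) (a + y) ⟨by linarith, by linarith⟩ ⟨by linarith, by linarith⟩
  obtain ⟨hbi, hbv⟩ := intervalIntegrable_rpow_neg_mul_rpow_sub hα0 hα1 hT0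
  obtain ⟨hci, hcv⟩ := integral_rpow_mul_holder_increment_eq_zero hα0 hα1 hβ hm hT0 hT h0 hd
  rw [← intervalIntegrable_iff_integrableOn_Ioc_of_le hT0.le] at hci
  rw [← intervalIntegral.integral_of_le hT0.le] at hcv
  have hsum := (hbi.const_mul (-(f (a + T) - f a))).add (hci.const_mul (1 - α))
  have hEq : EqOn (fun x => -(f (a + T) - f a) * (x ^ (-α) * (T - x) ^ (α - 1)) +
        (1 - α) * (x ^ (-α) * ∫ y in Ioi x, (h x - h y) * (y - x) ^ (α - 2)))
      (fun x => (a + x - a) ^ (-α) * weylRightReal f (a + T) α (a + x)) (Ioo 0 T) := by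
    intro x hx
    beta_reduce
    rw [weylRightReal_add hα1 hT hh hx
      (holder_increment_integrableOn hα1 hβ hm hT hd hx.1 hx.2).1, add_sub_cancel_left]
    ring
  constructor
  · have hi : IntervalIntegrable
        (fun x => (a + x - a) ^ (-α) * weylRightReal f (a + T) α (a + x)) volume 0 T := by
      rw [intervalIntegrable_iff_integrableOn_Ioo_of_le hT0.le] at hsum ⊢
      exact IntegrableOn.congr_fun hsum hEq measurableSet_Ioo
    have := hi.comp_sub_right a
    simpa [add_comm T a] using this
  · have hv := intervalIntegral.integral_comp_add_left (a := 0) (b := T)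
      (fun r => (r - a) ^ (-α) * weylRightReal f (a + T) α r) a
    rw [add_zero] at hv
    rw [← hv, intervalIntegral.integral_of_le hT0.le, integral_Ioc_eq_integral_Ioo,
      ← setIntegral_congr_fun measurableSet_Ioo hEq, ← integral_Ioc_eq_integral_Ioo,
      ← intervalIntegral.integral_of_le hT0.le,
      intervalIntegral.integral_add (hbi.const_mul _) (hci.const_mul _),
      intervalIntegral.integral_const_mul, intervalIntegral.integral_const_mul, hbv, hcv]
    ring

theorem integral_indicator_rpow_mul_weylRightReal {α β s a t C : ℝ} {f : ℝ → ℝ} (hα0 : 0 < α)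
    (hα1 : α < 1) (hβ : 1 - α < β) (hsa : s ≤ a) (hat : a < t)
    (hf : ∀ u v, u ∈ Icc s t → v ∈ Icc s t → |f v - f u| ≤ C * |v - u| ^ β) :
    IntervalIntegrable
        (fun r => (Ioi a).indicator (fun r => (r - a) ^ (-α)) r * weylRightReal f t α r)
        volume s t ∧
      ∫ r in s..t, (Ioi a).indicator (fun r => (r - a) ^ (-α)) r * weylRightReal f t α r =
        -(f t - f a) * (Gamma (1 - α) * Gamma α) := by
  obtain ⟨hi, hv⟩ := integral_rpow_mul_weylRightReal hα0 hα1 hβ hat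
    fun u v hu hv => hf u v ⟨hsa.trans hu.1, hu.2⟩ ⟨hsa.trans hv.1, hv.2⟩
  have hleft : EqOn (fun _ => (0 : ℝ))
      (fun r => (Ioi a).indicator (fun r => (r - a) ^ (-α)) r * weylRightReal f t α r)
      (Ioc s a) := by
    intro r hr
    simp [not_lt.2 hr.2]
  have hright : EqOn (fun r => (r - a) ^ (-α) * weylRightReal f t α r)
      (fun r => (Ioi a).indicator (fun r => (r - a) ^ (-α)) r * weylRightReal f t α r)
      (Ioc a t) := by
    intro r hr
    simp [hr.1]
  rw [← uIoc_of_le hsa] at hleft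
  rw [← uIoc_of_le hat.le] at hright
  have hil := IntervalIntegrable.congr (μ := volume) hleft intervalIntegrable_const
  have hir := IntervalIntegrable.congr hright hi
  refine ⟨hil.trans hir, ?_⟩
  rw [← intervalIntegral.integral_add_adjacent_intervals hil hir, ← hv,
    ← intervalIntegral.integral_congr_ae (Eventually.of_forall hleft),
    ← intervalIntegral.integral_congr_ae (Eventually.of_forall hright)]
  simp

theorem integral_indicator_sub_div_rpow {α s a r : ℝ} (hα0 : 0 < α) (hsa : s ≤ a) (hsr : s < r) :
    IntervalIntegrable (fun u => ((Ioi a).indicator (1 : ℝ → ℝ) r - (Ioi a).indicator 1 u) /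
        (r - u) ^ (α + 1)) volume s r ∧
      (Ioi a).indicator (1 : ℝ → ℝ) r / (r - s) ^ α +
        α * ∫ u in s..r, ((Ioi a).indicator (1 : ℝ → ℝ) r - (Ioi a).indicator 1 u) /
          (r - u) ^ (α + 1) = (Ioi a).indicator (fun r => (r - a) ^ (-α)) r := by
  rcases le_or_gt r a with hra | har
  · have hEq : EqOn (fun _ => (0 : ℝ)) (fun u => ((Ioi a).indicator (1 : ℝ → ℝ) r -
        (Ioi a).indicator 1 u) / (r - u) ^ (α + 1)) (uIoc s r) := by
      intro u hu
      rw [uIoc_of_le hsr.le] at hu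
      simp [not_lt.2 hra, not_lt.2 (hu.2.trans hra)]
    refine ⟨IntervalIntegrable.congr hEq intervalIntegrable_const, ?_⟩
    rw [← intervalIntegral.integral_congr_ae (Eventually.of_forall hEq)]
    simp [not_lt.2 hra]
  · have hleft : EqOn (fun u => (r - u) ^ (-(α + 1))) (fun u => ((Ioi a).indicator (1 : ℝ → ℝ) r -
        (Ioi a).indicator 1 u) / (r - u) ^ (α + 1)) (uIoc s a) := by
      intro u hu
      rw [uIoc_of_le hsa] at hu
      have : 0 ≤ r - u := by linarith [hu.2]
      beta_reduce
      rw [rpow_neg this]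
      simp [har, not_lt.2 hu.2]
    have hright : EqOn (fun _ => (0 : ℝ)) (fun u => ((Ioi a).indicator (1 : ℝ → ℝ) r -
        (Ioi a).indicator 1 u) / (r - u) ^ (α + 1)) (uIoc a r) := by
      intro u hu
      rw [uIoc_of_le har.le] at hu
      simp [har, hu.1]
    have hnot : (0 : ℝ) ∉ uIcc (r - a) (r - s) := by
      rw [uIcc_of_le (by linarith)]
      exact fun h0 => (sub_pos.2 har).not_ge h0.1
    have hpow : IntervalIntegrable (fun u => (r - u) ^ (-(α + 1))) volume s a := by
      have := ((intervalIntegral.intervalIntegrable_rpow (μ := volume) (r := -(α + 1))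
        (Or.inr hnot)).comp_sub_left r).symm
      simpa using this
    have hil := IntervalIntegrable.congr hleft hpow
    have hir := IntervalIntegrable.congr (μ := volume) hright intervalIntegrable_const
    refine ⟨hil.trans hir, ?_⟩
    rw [← intervalIntegral.integral_add_adjacent_intervals hil hir,
      ← intervalIntegral.integral_congr_ae (Eventually.of_forall hleft),
      ← intervalIntegral.integral_congr_ae (Eventually.of_forall hright),
      intervalIntegral.integral_comp_sub_left (fun v => v ^ (-(α + 1))),
      integral_rpow (Or.inr ⟨by linarith, hnot⟩), intervalIntegral.integral_zero, add_zero,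
      show -(α + 1) + 1 = -α by ring, indicator_of_mem (show r ∈ Ioi a from har),
      indicator_of_mem (show r ∈ Ioi a from har), Pi.one_apply, one_div,
      ← rpow_neg (sub_pos.2 hsr).le]
    field_simp
    ring

theorem weylLeft_eq_sum {ι : Type*} (S : Finset ι) {α s r : ℝ} {g : ℝ → ℝ} {c a : ι → ℝ}
    (hα0 : 0 < α) (hsr : s < r) (ha : ∀ j ∈ S, s ≤ a j)
    (hg : ∀ u ∈ Ioc s r, g u = ∑ j ∈ S, c j * (Ioi (a j)).indicator 1 u) :
    weylLeft g s α r = (1 / Gamma (1 - α)) *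
      ∑ j ∈ S, c j * (Ioi (a j)).indicator (fun r => (r - a j) ^ (-α)) r := by
  have hgr := hg r ⟨hsr, le_rfl⟩
  have hEq : ∫ u in s..r, (g r - g u) / (r - u) ^ (α + 1) =
      ∑ j ∈ S, c j * ∫ u in s..r, ((Ioi (a j)).indicator (1 : ℝ → ℝ) r -
        (Ioi (a j)).indicator 1 u) / (r - u) ^ (α + 1) := by
    simp_rw [← intervalIntegral.integral_const_mul]
    rw [← intervalIntegral.integral_finsetSum fun j hj =>
      (integral_indicator_sub_div_rpow hα0 (ha j hj) hsr).1.const_mul (c j)]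
    refine intervalIntegral.integral_congr_ae (Eventually.of_forall fun u hu => ?_)
    rw [uIoc_of_le hsr.le] at hu
    rw [hgr, hg u hu, ← Finset.sum_sub_distrib, Finset.sum_div]
    exact Finset.sum_congr rfl fun j _ => by ring
  rw [weylLeft, hEq, hgr, Finset.sum_div, Finset.mul_sum, ← Finset.sum_add_distrib]
  congr 1
  refine Finset.sum_congr rfl fun j hj => ?_
  rw [← (integral_indicator_sub_div_rpow hα0 (ha j hj) hsr).2]
  ring

/-- The jumps of a sequence, with first jump taken from zero. -/
def seqJump (G : ℕ → ℝ) (j : ℕ) : ℝ := G j - if j = 0 then 0 else G (j - 1)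

theorem sum_range_succ_seqJump (G : ℕ → ℝ) (m : ℕ) :
    ∑ j ∈ Finset.range (m + 1), seqJump G j = G m := by
  induction m with
  | zero => simp [seqJump]
  | succ m ih => rw [Finset.sum_range_succ, ih]; simp [seqJump]

theorem sum_seqJump_mul_sub (G F : ℕ → ℝ) (m : ℕ) :
    ∑ j ∈ Finset.range m, seqJump G j * (F m - F j) =
      ∑ k ∈ Finset.range m, G k * (F (k + 1) - F k) := by
  induction m with
  | zero => simp
  | succ m ih =>
    rw [Finset.sum_range_succ (fun k => G k * _), ← ih, ← sum_range_succ_seqJump G m,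
      Finset.sum_mul, Finset.sum_range_succ, Finset.sum_range_succ, ← add_assoc,
      ← Finset.sum_add_distrib]
    congr 1
    exact Finset.sum_congr rfl fun j _ => by ring

theorem step_eq_sum_indicator {n : ℕ} {τ : ℕ → ℝ} (hτ : ∀ k, k < n → τ k < τ (k + 1))
    {g : ℝ → ℝ} {G : ℕ → ℝ} (hg : ∀ k, k < n → ∀ r, τ k < r → r ≤ τ (k + 1) → g r = G k)
    {u : ℝ} (hu : u ∈ Ioc (τ 0) (τ n)) :
    g u = ∑ j ∈ Finset.range n, seqJump G j * (Ioi (τ j)).indicator 1 u := by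
  have hmono : ∀ i j, i ≤ j → j ≤ n → τ i ≤ τ j := by
    intro i j hij
    induction j, hij using Nat.le_induction with
    | base => exact fun _ => le_rfl
    | succ j _ ih => exact fun hj => (ih (by omega)).trans (hτ j (by omega)).le
  obtain ⟨k, hk, hk1, hk2⟩ : ∃ k < n, τ k < u ∧ u ≤ τ (k + 1) := by
    classical
    have hex : ∃ m, u ≤ τ m := ⟨n, hu.2⟩
    have hpos : Nat.find hex ≠ 0 := fun h0 => hu.1.not_ge (h0 ▸ Nat.find_spec hex)
    have hle : Nat.find hex ≤ n := Nat.find_min' hex hu.2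
    refine ⟨Nat.find hex - 1, by omega, not_le.1 (Nat.find_min hex (by omega)), ?_⟩
    rw [Nat.sub_add_cancel (by omega)]
    exact Nat.find_spec hex
  rw [hg k hk u hk1 hk2, ← sum_range_succ_seqJump G k,
    ← Finset.sum_subset (Finset.range_mono (show k + 1 ≤ n by omega))]
  · refine Finset.sum_congr rfl fun j hj => ?_
    have hj' : τ j < u := (hmono j k (by simpa [Nat.lt_succ_iff] using hj) hk.le).trans_lt hk1
    simp [hj']
  · intro j hj hjk
    rw [Finset.mem_range] at hj hjk
    have hj' : u ≤ τ j := hk2.trans (hmono (k + 1) j (by omega) hj.le)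
    simp [not_lt.2 hj']

/-- **Zähle's fractional-calculus representation of the Young integral of a step function.**
Let `1/2 < α < 1`, let `f : [s,t] → ℝ` be `β`-Hölder with `β > 1 - α`, and let `g` be a
step function adapted to a partition `s = τ_0 < … < τ_n = t` with values `g^k` on
`(τ_k, τ_{k+1}]`. Then
`∑_{k=0}^{n-1} g^k (f_{τ_{k+1}} - f_{τ_k}) = (-1)^α ∫_s^t (D^α_{s+} g)_r (D^{1-α}_{t-} F)_r dr`
with `(-1)^α = e^{-iπα}` and `F_r = f_r - f_t`. -/
theorem young_integral_step_fractional_repr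
    (α β s t : ℝ) (hα : α ∈ Set.Ioo (1/2 : ℝ) 1) (hβ : β ∈ Set.Ioc (1 - α) 1)
    (hst : s < t) (f : ℝ → ℝ) (Kf : ℝ)
    (hf : ∀ u v, u ∈ Set.Icc s t → v ∈ Set.Icc s t → |f v - f u| ≤ Kf * |v - u| ^ β)
    (n : ℕ) (hn : 0 < n) (τ : ℕ → ℝ) (hτ0 : τ 0 = s) (hτn : τ n = t)
    (hτmono : ∀ k, k < n → τ k < τ (k + 1))
    (g : ℝ → ℝ) (gval : ℕ → ℝ) (hgs : g s = gval 0)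
    (hg : ∀ k, k < n → ∀ r, τ k < r → r ≤ τ (k + 1) → g r = gval k) :
    ((∑ k ∈ Finset.range n, gval k * (f (τ (k + 1)) - f (τ k)) : ℝ) : ℂ) =
      Complex.exp (-(Real.pi * α) * Complex.I) *
        ∫ r in s..t, ((weylLeft g s α r : ℝ) : ℂ) * weylRight f t α r := by
  obtain ⟨hα2, hα1⟩ := hα
  have hα0 : 0 < α := by linarith
  have hmem : ∀ k, k ≤ n → s ≤ τ k := by
    intro k
    induction k with
    | zero => exact fun _ => hτ0.ge
    | succ k ih => exact fun hk => (ih (by omega)).trans (hτmono k (by omega)).le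
  have hlt : ∀ d, d < n → τ (n - 1 - d) < t := by
    intro d
    induction d with
    | zero =>
      intro _
      have := hτmono (n - 1) (by omega)
      rwa [Nat.sub_add_cancel hn, hτn] at this
    | succ d ih =>
      intro hd
      have := hτmono (n - 1 - (d + 1)) (by omega)
      rw [show n - 1 - (d + 1) + 1 = n - 1 - d by omega] at this
      exact this.trans (ih (by omega))
  have hτlt : ∀ j, j < n → τ j < t := fun j hj => by
    have := hlt (n - 1 - j) (by omega)
    rwa [show n - 1 - (n - 1 - j) = j by omega] at this
  have hterm : ∀ j ∈ Finset.range n, _ := fun j hj =>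
    integral_indicator_rpow_mul_weylRightReal hα0 hα1 hβ.1
      (hmem j (Finset.mem_range.1 hj).le) (hτlt j (Finset.mem_range.1 hj)) hf
  have hΓ1 : ((Gamma (1 - α) : ℝ) : ℂ) ≠ 0 :=
    Complex.ofReal_ne_zero.2 (Gamma_pos_of_pos (sub_pos.2 hα1)).ne'
  have hΓ2 : ((Gamma α : ℝ) : ℂ) ≠ 0 := Complex.ofReal_ne_zero.2 (Gamma_pos_of_pos hα0).ne'
  have hexp : Complex.exp (-(π * α) * Complex.I) * Complex.exp (-(π * (1 - α)) * Complex.I) =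
      -1 := by
    rw [← Complex.exp_add, show -(π * α) * Complex.I + -(π * (1 - α)) * Complex.I =
      -(π * Complex.I) by ring, Complex.exp_neg, Complex.exp_pi_mul_I]
    norm_num
  have hreal : ∫ r in s..t, ∑ j ∈ Finset.range n, seqJump gval j *
      ((Ioi (τ j)).indicator (fun r => (r - τ j) ^ (-α)) r * weylRightReal f t α r) =
      -(Gamma (1 - α) * Gamma α) *
        ∑ k ∈ Finset.range n, gval k * (f (τ (k + 1)) - f (τ k)) := by
    rw [intervalIntegral.integral_finsetSum fun j hj => (hterm j hj).1.const_mul _,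
      ← sum_seqJump_mul_sub gval (fun k => f (τ k)) n, Finset.mul_sum]
    refine Finset.sum_congr rfl fun j hj => ?_
    rw [intervalIntegral.integral_const_mul, (hterm j hj).2, hτn]
    ring
  have hcomplex : ∫ r in s..t, ((weylLeft g s α r : ℝ) : ℂ) * weylRight f t α r =
      ∫ r in s..t, (Complex.exp (-(π * (1 - α)) * Complex.I) / (Gamma (1 - α) * Gamma α)) *
        ((∑ j ∈ Finset.range n, seqJump gval j *
          ((Ioi (τ j)).indicator (fun r => (r - τ j) ^ (-α)) r * weylRightReal f t α r) : ℝ) :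
            ℂ) := by
    refine intervalIntegral.integral_congr_ae (Eventually.of_forall fun r hr => ?_)
    rw [uIoc_of_le hst.le] at hr
    rw [weylLeft_eq_sum (Finset.range n) (c := seqJump gval) (a := τ) hα0 hr.1
      (fun j hj => hmem j (Finset.mem_range.1 hj).le) fun u hu =>
        step_eq_sum_indicator hτmono hg
          ⟨by simpa only [hτ0] using hu.1, by simpa only [hτn] using hu.2.trans hr.2⟩]
    rw [weylRight, ← weylRightReal]
    simp_rw [← mul_assoc]
    rw [← Finset.sum_mul]
    push_cast
    field_simp
  rw [hcomplex, intervalIntegral.integral_const_mul, intervalIntegral.integral_ofReal, hreal,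
    ← mul_assoc, mul_div_assoc', hexp]
  push_cast
  field_simp
end

section
/- Let $Y$ solve the Young differential equation $dY_t=V(Y_t)dX_t$, $Y_0=y$, with $V\in\mathcal{C}^1_b(\mathbb{R}^m;\mathbb{R}^{m\times d})$ and $X$ a $\beta$-Hölder path, $\beta\in(1/2,1)$. Then $\|Y\|_\beta\le C(V,\beta,T)\max\{\|X\|_\beta,\|X\|_\beta^{1/\beta}\}$ and $\|Y\|_\infty\le|y|+C(V,\beta,T)\max\{\|X\|_\beta,\|X\|_\beta^{1/\beta}\}$. Moreover, there exists $C_0>0$ such that if $\|X\|_\beta|t-s|^\beta\le C_0$ then $\|Y\|_{s,t,\beta}\le C(V,\beta,T,C_0)\|X\|_\beta$. -/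
/-- The `β`-Hölder seminorm of `f` on `[s,t]`. -/
noncomputable def holderSemi {E : Type*} [NormedAddCommGroup E]
    (f : ℝ → E) (s t β : ℝ) : ℝ :=
  sSup {c | ∃ u v, s ≤ u ∧ u < v ∧ v ≤ t ∧ c = ‖f v - f u‖ / (v - u) ^ β}

/-- The supremum norm of `f` on `[s,t]`. -/
noncomputable def supNorm {E : Type*} [NormedAddCommGroup E] (f : ℝ → E) (s t : ℝ) : ℝ :=
  sSup {c | ∃ u, s ≤ u ∧ u ≤ t ∧ c = ‖f u‖}

/-- `RiemannSum g δ a b v`: `v` is the sum of the germ `g` over some partition of `[a, b]` of mesh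
less than `δ`. -/
inductive RiemannSum {E : Type*} [AddCommGroup E] (g : ℝ → ℝ → E) (δ a : ℝ) : ℝ → E → Prop
  | refl : RiemannSum g δ a a 0
  | step {b c : ℝ} {v : E} : RiemannSum g δ a b v → b ≤ c → c - b < δ →
      RiemannSum g δ a c (v + g b c)

namespace RiemannSum

variable {E : Type*} [AddCommGroup E] {g : ℝ → ℝ → E}

theorem mono {δ δ' a b : ℝ} {v : E} (h : RiemannSum g δ a b v) (hδ : δ ≤ δ') :
    RiemannSum g δ' a b v := by
  induction h with
  | refl => exact .refl
  | step _ h1 h2 ih => exact .step ih h1 (h2.trans_le hδ)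

theorem trans {δ a b c : ℝ} {v w : E} (h : RiemannSum g δ a b v) (h' : RiemannSum g δ b c w) :
    RiemannSum g δ a c (v + w) := by
  induction h' with
  | refl => simpa using h
  | step _ h1 h2 ih => rw [← add_assoc]; exact .step ih h1 h2

theorem single {δ a b : ℝ} (hab : a ≤ b) (hδ : b - a < δ) : RiemannSum g δ a b (g a b) := by
  simpa using step (g := g) (refl (δ := δ) (a := a)) hab hδ

theorem exists_of_le {δ a b : ℝ} (hδ : 0 < δ) (hab : a ≤ b) : ∃ v, RiemannSum g δ a b v := by
  have key : ∀ (n : ℕ) (b : ℝ), a ≤ b → b - a ≤ n * (δ / 2) → ∃ v, RiemannSum g δ a b v := by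
    intro n
    induction n with
    | zero =>
      intro b hab h
      obtain rfl : a = b := le_antisymm hab (by simpa using h)
      exact ⟨0, .refl⟩
    | succ n ih =>
      intro b hab h
      push_cast at h
      obtain ⟨v, hv⟩ := ih (max a (b - δ / 2)) (le_max_left _ _) (by
        rw [sub_le_iff_le_add]
        refine max_le ?_ (by linarith)
        have : 0 ≤ (n : ℝ) * (δ / 2) := by positivity
        linarith)
      have := le_max_right a (b - δ / 2)
      exact ⟨_, .step hv (max_le hab (by linarith)) (by linarith)⟩
  obtain ⟨n, hn⟩ := exists_nat_ge ((b - a) / (δ / 2))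
  exact key n b hab ((div_le_iff₀ (by positivity)).1 hn)

theorem exists_partition {δ a b : ℝ} {v : E} (h : RiemannSum g δ a b v) :
    ∃ (N : ℕ) (P : ℕ → ℝ), P 0 = a ∧ P N = b ∧
      (∀ k < N, P k ≤ P (k + 1) ∧ P (k + 1) - P k < δ) ∧
      v = ∑ k ∈ Finset.range N, g (P k) (P (k + 1)) := by
  induction h with
  | refl => exact ⟨0, fun _ ↦ a, rfl, rfl, by simp, by simp⟩
  | @step b c v _ h1 h2 ih =>
    obtain ⟨N, P, h0, hN, hP, hv⟩ := ih
    have hlt : ∀ k, k ≤ N → (if k ≤ N then P k else c) = P k := fun k hk ↦ if_pos hk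
    have hlast : (if N + 1 ≤ N then P (N + 1) else c) = c := if_neg (by omega)
    refine ⟨N + 1, fun k ↦ if k ≤ N then P k else c, ?_, hlast, ?_, ?_⟩
    · simpa using h0
    · intro k hk
      rcases Nat.lt_succ_iff_lt_or_eq.1 hk with hk | rfl
      · simp only [hlt k hk.le, hlt (k + 1) hk]
        exact hP k hk
      · simp only [le_refl, if_true, hlast, hN]
        exact ⟨h1, h2⟩
    · rw [Finset.sum_range_succ, hv]
      simp only [le_refl, if_true, hlast, hN]
      congr 1
      refine Finset.sum_congr rfl fun k hk ↦ ?_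
      have hk := Finset.mem_range.1 hk
      simp only [hlt k hk.le, hlt (k + 1) hk]

end RiemannSum

/-- The sum of `φ` over the `2 ^ n` intervals of the dyadic subdivision of `[s, t]`. -/
noncomputable def dyadicSum (φ : ℝ → ℝ → ℝ) : ℕ → ℝ → ℝ → ℝ
  | 0, s, t => φ s t
  | n + 1, s, t => dyadicSum φ n s ((s + t) / 2) + dyadicSum φ n ((s + t) / 2) t

theorem dyadicSum_mono {φ ψ : ℝ → ℝ → ℝ} (h : ∀ s t, φ s t ≤ ψ s t) (n : ℕ) (s t : ℝ) :
    dyadicSum φ n s t ≤ dyadicSum ψ n s t := by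
  induction n generalizing s t with
  | zero => exact h s t
  | succ n ih => exact add_le_add (ih _ _) (ih _ _)

theorem dyadicSum_nonneg {φ : ℝ → ℝ → ℝ} (h : ∀ s t, 0 ≤ φ s t) (n : ℕ) (s t : ℝ) :
    0 ≤ dyadicSum φ n s t := by
  induction n generalizing s t with
  | zero => exact h s t
  | succ n ih => exact add_nonneg (ih _ _) (ih _ _)

theorem dyadicSum_sum {ι : Type*} (S : Finset ι) (φ : ι → ℝ → ℝ → ℝ) (n : ℕ) (s t : ℝ) :
    dyadicSum (fun s t ↦ ∑ i ∈ S, φ i s t) n s t = ∑ i ∈ S, dyadicSum (φ i) n s t := by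
  induction n generalizing s t with
  | zero => rfl
  | succ n ih => simp only [dyadicSum, ih, Finset.sum_add_distrib]

/-- `F` is the indefinite integral of the germ `g` on `[0, T]`, as a limit of Riemann sums. -/
def HasRiemannIntegral {E : Type*} [NormedAddCommGroup E] (g : ℝ → ℝ → E) (F : ℝ → E) (T : ℝ) :
    Prop :=
  ∀ t, 0 ≤ t → t ≤ T → ∀ ε, 0 < ε → ∃ δ, 0 < δ ∧
    ∀ v, RiemannSum g δ 0 t v → ‖F t - F 0 - v‖ < ε

namespace HasRiemannIntegral

variable {E : Type*} [NormedAddCommGroup E] {g : ℝ → ℝ → E} {F : ℝ → E} {T : ℝ}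

theorem exists_riemannSum (h : HasRiemannIntegral g F T) {a b δ ε : ℝ} (ha : 0 ≤ a) (hab : a ≤ b)
    (hb : b ≤ T) (hδ : 0 < δ) (hε : 0 < ε) :
    ∃ v, RiemannSum g δ a b v ∧ ‖F b - F a - v‖ < ε := by
  obtain ⟨δa, hδa, Ha⟩ := h a ha (hab.trans hb) (ε / 2) (by positivity)
  obtain ⟨δb, hδb, Hb⟩ := h b (ha.trans hab) hb (ε / 2) (by positivity)
  have hδ' : 0 < min δ (min δa δb) := by positivity
  obtain ⟨v, hv⟩ := RiemannSum.exists_of_le (g := g) hδ' ha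
  obtain ⟨w, hw⟩ := RiemannSum.exists_of_le (g := g) hδ' hab
  refine ⟨w, hw.mono (min_le_left _ _), ?_⟩
  have h1 := Ha v (hv.mono ((min_le_right _ _).trans (min_le_left _ _)))
  have h2 := Hb _ ((hv.trans hw).mono ((min_le_right _ _).trans (min_le_right _ _)))
  have h3 : F b - F a - w = (F b - F 0 - (v + w)) - (F a - F 0 - v) := by abel
  rw [h3]
  linarith [norm_sub_le (F b - F 0 - (v + w)) (F a - F 0 - v)]

/-- The sum of the nonnegative parts of the local errors is itself a global error, up to an
arbitrarily small quantity: refine the intervals where the local error is negative. -/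
theorem exists_riemannSum_posPart [NormedSpace ℝ E] (h : HasRiemannIntegral g F T)
    (L : E →L[ℝ] ℝ) {δ : ℝ} (hδ : 0 < δ) (n : ℕ) {s t η : ℝ} (hs : 0 ≤ s) (hst : s ≤ t)
    (ht : t ≤ T) (hmesh : (t - s) / 2 ^ n < δ) (hη : 0 < η) :
    ∃ v, RiemannSum g δ s t v ∧
      |L (F t - F s - v) - dyadicSum (fun s t ↦ max (L (F t - F s - g s t)) 0) n s t| < η := by
  induction n generalizing s t η with
  | zero =>
    rcases le_total 0 (L (F t - F s - g s t)) with h0 | h0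
    · refine ⟨g s t, .single hst (by simpa using hmesh), ?_⟩
      simp only [dyadicSum, max_eq_left h0]
      simpa using hη
    · obtain ⟨v, hv, hv'⟩ := h.exists_riemannSum (ε := η / (‖L‖ + 1)) hs hst ht hδ (by positivity)
      refine ⟨v, hv, ?_⟩
      simp only [dyadicSum, max_eq_right h0, sub_zero]
      rw [lt_div_iff₀ (by positivity)] at hv'
      have h1 := L.le_opNorm (F t - F s - v)
      rw [Real.norm_eq_abs] at h1
      nlinarith [norm_nonneg (F t - F s - v)]
  | succ n ih =>
    have hm1 : ((s + t) / 2 - s) / 2 ^ n < δ := by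
      refine lt_of_eq_of_lt ?_ hmesh
      rw [pow_succ]; field_simp; ring
    have hm2 : (t - (s + t) / 2) / 2 ^ n < δ := by
      refine lt_of_eq_of_lt ?_ hmesh
      rw [pow_succ]; field_simp; ring
    obtain ⟨v, hv, hv'⟩ := ih (η := η / 2) hs (by linarith) (by linarith) hm1 (by positivity)
    obtain ⟨w, hw, hw'⟩ := ih (η := η / 2) (by linarith) (by linarith) ht hm2 (by positivity)
    refine ⟨v + w, hv.trans hw, ?_⟩
    have h3 : F t - F s - (v + w)
        = (F ((s + t) / 2) - F s - v) + (F t - F ((s + t) / 2) - w) := by abel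
    rw [h3, map_add]
    simp only [dyadicSum]
    rw [abs_lt] at hv' hw' ⊢
    constructor <;> linarith [hv'.1, hv'.2, hw'.1, hw'.2]

theorem eventually_dyadicSum_posPart_le [NormedSpace ℝ E] (h : HasRiemannIntegral g F T)
    (L : E →L[ℝ] ℝ) {s t ε : ℝ} (hs : 0 ≤ s) (hst : s ≤ t) (ht : t ≤ T) (hε : 0 < ε) :
    ∀ᶠ n in Filter.atTop,
      dyadicSum (fun s t ↦ max (L (F t - F s - g s t)) 0) n s t ≤ ε := by
  have hη : 0 < ε / (2 * (‖L‖ + 1)) := by positivity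
  obtain ⟨δ, hδ, H⟩ := h t (hs.trans hst) ht _ hη
  have hlim : Filter.Tendsto (fun n : ℕ ↦ (t - s) / (2 : ℝ) ^ n) Filter.atTop (nhds 0) :=
    tendsto_const_nhds.div_atTop (tendsto_pow_atTop_atTop_of_one_lt one_lt_two)
  filter_upwards [hlim.eventually_lt_const hδ] with n hn
  refine le_of_forall_pos_le_add fun η hη' ↦ ?_
  obtain ⟨w, hw, hw'⟩ := h.exists_riemannSum_posPart L hδ n hs hst ht hn hη'
  obtain ⟨v, hv, hv'⟩ := h.exists_riemannSum le_rfl hs (hst.trans ht) hδ hη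
  have h1 := H _ (hv.trans hw)
  have h2 : F t - F s - w = (F t - F 0 - (v + w)) - (F s - F 0 - v) := by abel
  have h3 : ‖F t - F s - w‖ ≤ 2 * (ε / (2 * (‖L‖ + 1))) := by
    rw [h2]
    linarith [norm_sub_le (F t - F 0 - (v + w)) (F s - F 0 - v)]
  have h4 : L (F t - F s - w) ≤ ε := by
    calc L (F t - F s - w) ≤ ‖L (F t - F s - w)‖ := Real.le_norm_self _
      _ ≤ ‖L‖ * ‖F t - F s - w‖ := L.le_opNorm _
      _ ≤ (‖L‖ + 1) * (2 * (ε / (2 * (‖L‖ + 1)))) := by gcongr; linarith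
      _ = ε := by field_simp
  linarith [(abs_lt.1 hw').1]

/-- **Saks–Henstock lemma** along dyadic subdivisions. -/
theorem tendsto_dyadicSum_norm {m : ℕ} {g : ℝ → ℝ → Fin m → ℝ} {F : ℝ → Fin m → ℝ}
    (h : HasRiemannIntegral g F T) {s t : ℝ} (hs : 0 ≤ s) (hst : s ≤ t) (ht : t ≤ T) :
    Filter.Tendsto (fun n ↦ dyadicSum (fun s t ↦ ‖F t - F s - g s t‖) n s t)
      Filter.atTop (nhds 0) := by
  let π : Fin m → Bool → (Fin m → ℝ) →L[ℝ] ℝ := fun i b ↦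
    if b then ContinuousLinearMap.proj i else -ContinuousLinearMap.proj i
  have hpi : ∀ v : Fin m → ℝ, ‖v‖ ≤ ∑ p : Fin m × Bool, max (π p.1 p.2 v) 0 := by
    intro v
    have hnn : ∀ p : Fin m × Bool, 0 ≤ max (π p.1 p.2 v) 0 := fun p ↦ le_max_right _ _
    refine (pi_norm_le_iff_of_nonneg (Finset.sum_nonneg fun p _ ↦ hnn p)).2 fun i ↦ ?_
    rcases le_total 0 (v i) with h0 | h0
    · refine le_trans ?_ (Finset.single_le_sum (fun p _ ↦ hnn p) (Finset.mem_univ (i, true)))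
      simp [π, abs_of_nonneg h0]
    · refine le_trans ?_ (Finset.single_le_sum (fun p _ ↦ hnn p) (Finset.mem_univ (i, false)))
      simp [π, abs_of_nonpos h0]
  rw [Metric.tendsto_atTop']
  intro ε hε
  have hc : 0 < ε / (Fintype.card (Fin m × Bool) + 1) := by positivity
  have hev : ∀ᶠ n in Filter.atTop, ∀ p : Fin m × Bool,
      dyadicSum (fun s t ↦ max (π p.1 p.2 (F t - F s - g s t)) 0) n s t
        ≤ ε / (Fintype.card (Fin m × Bool) + 1) :=
    Filter.eventually_all.2 fun p ↦ h.eventually_dyadicSum_posPart_le _ hs hst ht hc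
  obtain ⟨N, hN⟩ := Filter.eventually_atTop.1 hev
  refine ⟨N, fun n hn ↦ ?_⟩
  rw [Real.dist_0_eq_abs, abs_of_nonneg (dyadicSum_nonneg (fun _ _ ↦ norm_nonneg _) _ _ _)]
  calc dyadicSum (fun s t ↦ ‖F t - F s - g s t‖) n s t
      ≤ dyadicSum (fun s t ↦ ∑ p : Fin m × Bool, max (π p.1 p.2 (F t - F s - g s t)) 0) n s t :=
        dyadicSum_mono (fun _ _ ↦ hpi _) _ _ _
    _ = ∑ p : Fin m × Bool,
          dyadicSum (fun s t ↦ max (π p.1 p.2 (F t - F s - g s t)) 0) n s t :=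
        dyadicSum_sum _ (fun (p : Fin m × Bool) s t ↦ max (π p.1 p.2 (F t - F s - g s t)) 0) _ _ _
    _ ≤ ∑ _p : Fin m × Bool, ε / (Fintype.card (Fin m × Bool) + 1) :=
        Finset.sum_le_sum fun p _ ↦ hN n hn.le p
    _ < ε := by
        rw [Finset.sum_const, Finset.card_univ, nsmul_eq_mul, mul_div_assoc',
          div_lt_iff₀ (by positivity)]
        linarith [mul_comm ε (Fintype.card (Fin m × Bool) : ℝ)]

end HasRiemannIntegral

/-- Dyadic sewing with multiplicative errors: a function `R` that is almost additive under
bisection is of order `2β`, up to its dyadic sums. -/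
theorem le_add_dyadicSum_of_bisection {R : ℝ → ℝ → ℝ} {T β M θ : ℝ} (hM : 0 ≤ M)
    (hθ : 2 * θ ^ 2 < 1) (hθ0 : 0 ≤ θ) (hθ1 : θ < 1) (hβ : (1 / 2 : ℝ) ^ β = θ)
    (hR : ∀ s t, 0 ≤ R s t)
    (hbis : ∀ s t, 0 ≤ s → s ≤ t → t ≤ T →
      R s t ≤ R s ((s + t) / 2) * (1 + M * ((t - s) / 2) ^ β) + R ((s + t) / 2) t
        + (M * ((t - s) / 2) ^ β) ^ 2)
    (n : ℕ) {s t : ℝ} (hs : 0 ≤ s) (hst : s ≤ t) (ht : t ≤ T)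
    (h1 : M * (t - s) ^ β ≤ (1 - 2 * θ ^ 2) / 2) (h2 : M * (t - s) ^ β ≤ (1 - θ) / 2) :
    R s t ≤ 2 / (1 - 2 * θ ^ 2) * (M * (t - s) ^ β) ^ 2
      + (1 + 2 / (1 - θ) * (M * (t - s) ^ β)) * dyadicSum R n s t := by
  induction n generalizing s t with
  | zero =>
    have hx : 0 ≤ M * (t - s) ^ β := mul_nonneg hM (Real.rpow_nonneg (by linarith) _)
    have hA : 0 ≤ 2 / (1 - 2 * θ ^ 2) * (M * (t - s) ^ β) ^ 2 :=
      mul_nonneg (div_nonneg zero_le_two (by linarith)) (sq_nonneg _)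
    have hc : 0 ≤ 2 / (1 - θ) * (M * (t - s) ^ β) :=
      mul_nonneg (div_nonneg zero_le_two (by linarith)) hx
    simp only [dyadicSum]
    nlinarith [mul_nonneg hc (hR s t)]
  | succ n ih =>
    have hhalf : M * ((t - s) / 2) ^ β = θ * (M * (t - s) ^ β) := by
      rw [div_eq_mul_one_div, Real.mul_rpow (by linarith) (by norm_num), hβ]; ring
    have hm1 : (s + t) / 2 - s = (t - s) / 2 := by ring
    have hm2 : t - (s + t) / 2 = (t - s) / 2 := by ring
    have hb := hbis s t hs hst ht
    have ih1 := ih (s := s) (t := (s + t) / 2) hs (by linarith) (by linarith)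
    have ih2 := ih (s := (s + t) / 2) (t := t) (by linarith) (by linarith) ht
    rw [hm1, hhalf] at ih1
    rw [hm2, hhalf] at ih2
    rw [hhalf] at hb
    have hx : 0 ≤ M * (t - s) ^ β := mul_nonneg hM (Real.rpow_nonneg (by linarith) _)
    simp only [dyadicSum]
    have hE1 := dyadicSum_nonneg hR n s ((s + t) / 2)
    have hE2 := dyadicSum_nonneg hR n ((s + t) / 2) t
    generalize dyadicSum R n s ((s + t) / 2) = E₁ at *
    generalize dyadicSum R n ((s + t) / 2) t = E₂ at *
    generalize M * (t - s) ^ β = x at *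
    have hθx : θ * x ≤ x := mul_le_of_le_one_left hx hθ1.le
    replace ih1 := ih1 (hθx.trans h1) (hθx.trans h2)
    replace ih2 := ih2 (hθx.trans h1) (hθx.trans h2)
    have hA0 : 0 ≤ 2 / (1 - 2 * θ ^ 2) := div_nonneg zero_le_two (by linarith)
    have hA : 2 / (1 - 2 * θ ^ 2) * (1 - 2 * θ ^ 2) = 2 := div_mul_cancel₀ _ (by linarith)
    have hc0 : 0 ≤ 2 / (1 - θ) := div_nonneg zero_le_two (by linarith)
    have hc : 2 / (1 - θ) * (1 - θ) = 2 := div_mul_cancel₀ _ (by linarith)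
    generalize 2 / (1 - 2 * θ ^ 2) = A at *
    generalize 2 / (1 - θ) = c at *
    have hθx0 : 0 ≤ θ * x := mul_nonneg hθ0 hx
    have hquad : θ ^ 2 * (A * (2 + θ * x) + 1) ≤ A := by
      have h3 : θ ^ 2 * (θ * x) ≤ (1 - 2 * θ ^ 2) / 2 := by
        nlinarith [mul_nonneg hθx0 (sub_nonneg.2 (show θ ^ 2 ≤ 1 by nlinarith))]
      nlinarith [mul_le_mul_of_nonneg_left h3 hA0]
    have hlin : (1 + c * (θ * x)) * (1 + θ * x) ≤ 1 + c * x := by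
      have h3 : θ ^ 2 * x ≤ (1 - θ) / 2 := by
        nlinarith [mul_nonneg hx (sub_nonneg.2 (show θ ^ 2 ≤ 1 by nlinarith))]
      have h4 : c * θ + θ + c * (θ ^ 2 * x) ≤ c := by
        nlinarith [mul_le_mul_of_nonneg_left h3 hc0]
      nlinarith [mul_le_mul_of_nonneg_left h4 hx]
    have hlin' : 1 + c * (θ * x) ≤ 1 + c * x := by
      have := mul_le_mul_of_nonneg_left hθx hc0
      linarith
    calc R s t
        ≤ R s ((s + t) / 2) * (1 + θ * x) + R ((s + t) / 2) t + (θ * x) ^ 2 := hb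
      _ ≤ (A * (θ * x) ^ 2 + (1 + c * (θ * x)) * E₁) * (1 + θ * x)
          + (A * (θ * x) ^ 2 + (1 + c * (θ * x)) * E₂) + (θ * x) ^ 2 := by gcongr
      _ = θ ^ 2 * (A * (2 + θ * x) + 1) * x ^ 2
          + ((1 + c * (θ * x)) * (1 + θ * x) * E₁ + (1 + c * (θ * x)) * E₂) := by ring
      _ ≤ A * x ^ 2 + ((1 + c * x) * E₁ + (1 + c * x) * E₂) := by gcongr
      _ = A * x ^ 2 + (1 + c * x) * (E₁ + E₂) := by ring

/-- A path driven by the Young germ `V (Y s) (X t - X s)` is locally `β`-Hölder, with no a priori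
regularity. -/
theorem norm_sub_le_of_hasRiemannIntegral {G : Type*} [NormedAddCommGroup G] [NormedSpace ℝ G]
    {m : ℕ} {β T L K θ : ℝ} (hL : 0 ≤ L) (hK : 0 ≤ K)
    (hβ : (1 / 2 : ℝ) ^ β = θ) (hθ : 2 * θ ^ 2 < 1) (hθ1 : θ < 1)
    {V : (Fin m → ℝ) → G →L[ℝ] (Fin m → ℝ)} (hV : ∀ z, ‖V z‖ ≤ L)
    (hVL : ∀ z w, ‖V z - V w‖ ≤ L * ‖z - w‖) {X : ℝ → G} {Y : ℝ → Fin m → ℝ}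
    (hX : ∀ u v, 0 ≤ u → u ≤ v → v ≤ T → ‖X v - X u‖ ≤ K * (v - u) ^ β)
    (hY : HasRiemannIntegral (fun s t ↦ V (Y s) (X t - X s)) Y T)
    {s t : ℝ} (hs : 0 ≤ s) (hst : s ≤ t) (ht : t ≤ T)
    (h1 : L * K * (t - s) ^ β ≤ (1 - 2 * θ ^ 2) / 2) (h2 : L * K * (t - s) ^ β ≤ (1 - θ) / 2) :
    ‖Y t - Y s‖ ≤ 2 * (L * K * (t - s) ^ β) := by
  have hθ0 : 0 ≤ θ := hβ ▸ Real.rpow_nonneg (by norm_num) _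
  have hgerm : ∀ s t, 0 ≤ s → s ≤ t → t ≤ T →
      ‖V (Y s) (X t - X s)‖ ≤ L * K * (t - s) ^ β := fun s t hs hst ht ↦ by
    rw [mul_assoc]
    exact (V (Y s)).le_of_opNorm_le_of_le (hV _) (hX s t hs hst ht)
  set R : ℝ → ℝ → ℝ := fun s t ↦ ‖Y t - Y s - V (Y s) (X t - X s)‖ with hRdef
  have hincr : ∀ s t, 0 ≤ s → s ≤ t → t ≤ T → ‖Y t - Y s‖ ≤ L * K * (t - s) ^ β + R s t :=
    fun s t hs hst ht ↦ by
      have := norm_add_le (V (Y s) (X t - X s)) (Y t - Y s - V (Y s) (X t - X s))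
      rw [add_sub_cancel] at this
      exact this.trans (add_le_add_left (hgerm s t hs hst ht) _)
  have hbis : ∀ s t, 0 ≤ s → s ≤ t → t ≤ T →
      R s t ≤ R s ((s + t) / 2) * (1 + L * K * ((t - s) / 2) ^ β) + R ((s + t) / 2) t
        + (L * K * ((t - s) / 2) ^ β) ^ 2 := by
    intro s t hs hst ht
    have hm1 : (s + t) / 2 - s = (t - s) / 2 := by ring
    have hm2 : t - (s + t) / 2 = (t - s) / 2 := by ring
    have hi := hincr s ((s + t) / 2) hs (by linarith) (by linarith)
    have hx := hX ((s + t) / 2) t (by linarith) (by linarith) ht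
    rw [hm1] at hi
    rw [hm2] at hx
    set u := (s + t) / 2
    have hsplit : Y t - Y s - V (Y s) (X t - X s) = (Y u - Y s - V (Y s) (X u - X s))
        + (Y t - Y u - V (Y u) (X t - X u)) + (V (Y u) - V (Y s)) (X t - X u) := by
      simp only [map_sub, sub_apply]
      abel
    have hcross : ‖(V (Y u) - V (Y s)) (X t - X u)‖
        ≤ L * (L * K * ((t - s) / 2) ^ β + R s u) * (K * ((t - s) / 2) ^ β) :=
      ContinuousLinearMap.le_of_opNorm_le_of_le _
        ((hVL _ _).trans (mul_le_mul_of_nonneg_left hi hL)) hx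
    have htri : R s t ≤ R s u + R u t + ‖(V (Y u) - V (Y s)) (X t - X u)‖ := by
      simp only [hRdef]
      rw [hsplit]
      exact norm_add₃_le
    linarith
  have hM : 0 ≤ L * K := mul_nonneg hL hK
  have hR : R s t ≤ 2 / (1 - 2 * θ ^ 2) * (L * K * (t - s) ^ β) ^ 2 := by
    have hlim := ((hY.tendsto_dyadicSum_norm hs hst ht).const_mul
      (1 + 2 / (1 - θ) * (L * K * (t - s) ^ β))).const_add
      (2 / (1 - 2 * θ ^ 2) * (L * K * (t - s) ^ β) ^ 2)
    rw [mul_zero, add_zero] at hlim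
    exact ge_of_tendsto' hlim fun n ↦ le_add_dyadicSum_of_bisection hM hθ hθ0 hθ1 hβ
      (fun _ _ ↦ norm_nonneg _) hbis n hs hst ht h1 h2
  have hx : 0 ≤ L * K * (t - s) ^ β := mul_nonneg hM (Real.rpow_nonneg (by linarith) _)
  have h3 : 2 / (1 - 2 * θ ^ 2) * (L * K * (t - s) ^ β) ≤ 1 := by
    rw [div_mul_eq_mul_div, div_le_one (by linarith)]
    linarith
  have h4 := mul_le_mul_of_nonneg_right h3 hx
  linarith [hincr s t hs hst ht]

/-- A local Hölder bound on intervals with `K * (t - s) ^ β ≤ c` globalizes. -/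
theorem norm_sub_le_of_local_holder {E : Type*} [NormedAddCommGroup E] {f : ℝ → E}
    {T β K c D : ℝ} (hβ0 : 0 < β) (hβ1 : β ≤ 1) (hK : 0 ≤ K) (hc : 0 < c) (hD : 0 ≤ D)
    (hf : ∀ s t, 0 ≤ s → s ≤ t → t ≤ T → K * (t - s) ^ β ≤ c →
      ‖f t - f s‖ ≤ D * K * (t - s) ^ β)
    {u v : ℝ} (hu : 0 ≤ u) (huv : u ≤ v) (hv : v ≤ T) :
    ‖f v - f u‖ ≤ (D + 2 * (D * c) / c ^ (1 / β) * T ^ (1 - β)) * max K (K ^ (1 / β))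
      * (v - u) ^ β := by
  have hT : 0 ≤ T := hu.trans (huv.trans hv)
  have hh : 0 ≤ v - u := sub_nonneg.2 huv
  have hhβ : 0 ≤ (v - u) ^ β := Real.rpow_nonneg hh _
  have hB : 0 ≤ 2 * (D * c) / c ^ (1 / β) * T ^ (1 - β) := by positivity
  rcases le_or_gt (K * (v - u) ^ β) c with hsmall | hbig
  · refine (hf u v hu huv hv hsmall).trans ?_
    gcongr
    · linarith
    · exact le_max_left _ _
  have hKpos : 0 < K := by
    rcases hK.eq_or_lt with rfl | h
    · rw [zero_mul] at hbig; linarith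
    · exact h
  set τ := (c / K) ^ (1 / β) with hτ
  have hτpos : 0 < τ := by positivity
  have hτβ : K * τ ^ β = c := by
    rw [hτ, ← Real.rpow_mul (by positivity), one_div_mul_cancel hβ0.ne', Real.rpow_one,
      mul_div_cancel₀ _ hKpos.ne']
  have hchain : ∀ (n : ℕ) (w : ℝ), u ≤ w → w ≤ T → w - u ≤ n * τ →
      ‖f w - f u‖ ≤ n * (D * c) := by
    intro n
    induction n with
    | zero =>
      intro w huw _ h
      obtain rfl : u = w := le_antisymm huw (by simpa using h)
      simp
    | succ n ih =>
      intro w huw hw h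
      push_cast at h ⊢
      set z := max u (w - τ)
      have hz1 : u ≤ z := le_max_left _ _
      have hz2 : w - τ ≤ z := le_max_right _ _
      have hz3 : z ≤ w := max_le huw (by linarith)
      have hzu : z - u ≤ n * τ := by
        rw [sub_le_iff_le_add]
        refine max_le ?_ (by linarith)
        have : 0 ≤ (n : ℝ) * τ := by positivity
        linarith
      have hstep : K * (w - z) ^ β ≤ c := by
        rw [← hτβ]
        gcongr
        linarith
      have h1 := ih z hz1 (hz3.trans hw) hzu
      have h2 := hf z w (hu.trans hz1) hz3 hw hstep
      have h3 : D * K * (w - z) ^ β ≤ D * c := by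
        rw [mul_assoc]
        exact mul_le_mul_of_nonneg_left hstep hD
      have h4 : f w - f u = (f w - f z) + (f z - f u) := by abel
      rw [h4]
      linarith [norm_add_le (f w - f z) (f z - f u)]
  have hτlt : τ < v - u := by
    by_contra! hle
    have : (v - u) ^ β ≤ τ ^ β := by gcongr
    have := mul_le_mul_of_nonneg_left this hK
    linarith
  have hceil : (⌈(v - u) / τ⌉₊ : ℝ) ≤ 2 * ((v - u) / τ) := by
    have h1 := Nat.ceil_lt_add_one (div_nonneg hh hτpos.le)
    have h2 : 1 < (v - u) / τ := (one_lt_div hτpos).2 hτlt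
    linarith
  have hmain := hchain _ v huv hv ((div_le_iff₀ hτpos).1 (Nat.le_ceil ((v - u) / τ)))
  have hτ' : (v - u) / τ = (v - u) ^ (1 - β) * (v - u) ^ β * (K ^ (1 / β) / c ^ (1 / β)) := by
    rw [hτ, Real.div_rpow hc.le hK, ← Real.rpow_add (hτpos.trans hτlt), sub_add_cancel,
      Real.rpow_one, div_div_eq_mul_div, mul_div_assoc]
  have hpow : (v - u) ^ (1 - β) ≤ T ^ (1 - β) := by
    gcongr
    linarith
  calc ‖f v - f u‖ ≤ ⌈(v - u) / τ⌉₊ * (D * c) := hmain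
    _ ≤ 2 * ((v - u) / τ) * (D * c) := by gcongr
    _ = 2 * (D * c) / c ^ (1 / β) * (v - u) ^ (1 - β) * K ^ (1 / β) * (v - u) ^ β := by
        rw [hτ']; ring
    _ ≤ (D + 2 * (D * c) / c ^ (1 / β) * T ^ (1 - β)) * max K (K ^ (1 / β))
        * (v - u) ^ β := by
      gcongr
      · exact (mul_le_mul_of_nonneg_left hpow (by positivity)).trans (le_add_of_nonneg_left hD)
      · exact le_max_right _ _

theorem holderSemi_le {E : Type*} [NormedAddCommGroup E] {f : ℝ → E} {s t β B : ℝ} (hB : 0 ≤ B)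
    (h : ∀ u v, s ≤ u → u < v → v ≤ t → ‖f v - f u‖ ≤ B * (v - u) ^ β) :
    holderSemi f s t β ≤ B := by
  refine Real.sSup_le ?_ hB
  rintro _ ⟨u, v, hu, huv, hv, rfl⟩
  exact (div_le_iff₀ (Real.rpow_pos_of_pos (sub_pos.2 huv) _)).2 (h u v hu huv hv)

/-- **A priori bounds for solutions of Young differential equations.**
Let `Y` solve `dY_t = V(Y_t) dX_t`, `Y_0 = y`, with `V ∈ C¹_b(ℝ^m; ℝ^{m×d})` and `X` a
`β`-Hölder path, `β ∈ (1/2,1)`; the equation is understood pathwise via Young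
integration, i.e. `Y_t - y` is the limit of Riemann–Stieltjes sums of `V(Y_s) dX_s`.
Then `‖Y‖_β ≤ C max{‖X‖_β, ‖X‖_β^{1/β}}`,
`‖Y‖_∞ ≤ |y| + C max{‖X‖_β, ‖X‖_β^{1/β}}` with `C = C(V,β,T)`, and there is `C₀ > 0`
such that `‖X‖_β |t-s|^β ≤ C₀` implies `‖Y‖_{s,t,β} ≤ C' ‖X‖_β`. -/
theorem young_sde_apriori_bounds
    (m d : ℕ) (β T : ℝ) (hβ : β ∈ Set.Ioo (1/2 : ℝ) 1) (hT : 0 < T)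
    (V : (Fin m → ℝ) → ((Fin d → ℝ) →L[ℝ] (Fin m → ℝ))) (Cv : ℝ)
    (hVdiff : Differentiable ℝ V)
    (hVb : ∀ z, ‖V z‖ ≤ Cv ∧ ‖fderiv ℝ V z‖ ≤ Cv) :
    ∃ C C0 C' : ℝ, 0 < C ∧ 0 < C0 ∧ 0 < C' ∧
      ∀ (X : ℝ → (Fin d → ℝ)) (Y : ℝ → (Fin m → ℝ)) (y : Fin m → ℝ) (K : ℝ), 0 ≤ K →
      (∀ u v : ℝ, 0 ≤ u → u < v → v ≤ T → ‖X v - X u‖ ≤ K * (v - u) ^ β) →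
      Y 0 = y →
      -- `Y` solves the Young differential equation: for every `t ∈ [0,T]`, the
      -- Riemann–Stieltjes sums of `∫_0^t V(Y_s) dX_s` converge to `Y_t - y`
      (∀ t : ℝ, 0 ≤ t → t ≤ T → ∀ ε : ℝ, 0 < ε → ∃ δ : ℝ, 0 < δ ∧
        ∀ (N : ℕ) (P : ℕ → ℝ), P 0 = 0 → P N = t →
          (∀ k : ℕ, k < N → P k ≤ P (k + 1) ∧ P (k + 1) - P k < δ) →
          ‖Y t - y - ∑ k ∈ Finset.range N, V (Y (P k)) (X (P (k + 1)) - X (P k))‖ < ε) →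
      (holderSemi Y 0 T β ≤ C * max K (K ^ (1 / β)) ∧
        supNorm Y 0 T ≤ ‖y‖ + C * max K (K ^ (1 / β)) ∧
        ∀ s t : ℝ, 0 ≤ s → s < t → t ≤ T → K * (t - s) ^ β ≤ C0 →
          holderSemi Y s t β ≤ C' * K) := by
  obtain ⟨hβ2, hβ1⟩ := hβ
  have hβ0 : 0 < β := by linarith
  obtain ⟨θ, hθdef⟩ : ∃ θ, (1 / 2 : ℝ) ^ β = θ := ⟨_, rfl⟩
  have hθ1 : θ < 1 := hθdef ▸ Real.rpow_lt_one (by norm_num) (by norm_num) hβ0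
  have hθ : 2 * θ ^ 2 < 1 := by
    have h1 : θ ^ 2 < 1 / 2 := by
      rw [← hθdef, ← Real.rpow_natCast, ← Real.rpow_mul (by norm_num)]
      calc (1 / 2 : ℝ) ^ (β * (2 : ℕ)) < (1 / 2 : ℝ) ^ (1 : ℝ) :=
            Real.rpow_lt_rpow_of_exponent_gt (by norm_num) (by norm_num)
              (by push_cast; linarith)
        _ = 1 / 2 := Real.rpow_one _
    linarith
  have hCv : 0 ≤ Cv := (norm_nonneg _).trans (hVb 0).1
  have hL : 0 < Cv + 1 := by linarith
  have hV : ∀ z, ‖V z‖ ≤ Cv + 1 := fun z ↦ by linarith [(hVb z).1]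
  have hVL : ∀ z w, ‖V z - V w‖ ≤ (Cv + 1) * ‖z - w‖ := fun z w ↦
    convex_univ.norm_image_sub_le_of_norm_fderiv_le (fun x _ ↦ hVdiff x)
      (fun x _ ↦ by linarith [(hVb x).2]) (Set.mem_univ w) (Set.mem_univ z)
  obtain ⟨κ, hκ0, hκ1, hκ2⟩ : ∃ κ, 0 < κ ∧ κ ≤ (1 - 2 * θ ^ 2) / 2 ∧ κ ≤ (1 - θ) / 2 :=
    ⟨_, lt_min (by linarith) (by linarith), min_le_left _ _, min_le_right _ _⟩
  set D := 2 * (Cv + 1) with hD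
  have hD0 : 0 < D := by positivity
  set c := κ / (Cv + 1) with hc
  have hc0 : 0 < c := by positivity
  set B := D + 2 * (D * c) / c ^ (1 / β) * T ^ (1 - β) with hB
  have hB0 : 0 < B := by positivity
  refine ⟨B * (1 + T ^ β), c, D, by positivity, hc0, hD0, ?_⟩
  intro X Y y K hK hX hY0 hY
  have hX' : ∀ u v, 0 ≤ u → u ≤ v → v ≤ T → ‖X v - X u‖ ≤ K * (v - u) ^ β := by
    intro u v hu huv hv
    rcases huv.eq_or_lt with rfl | h
    · simp [Real.zero_rpow hβ0.ne']
    · exact hX u v hu h hv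
  have hint : HasRiemannIntegral (fun s t ↦ V (Y s) (X t - X s)) Y T := by
    intro t ht0 htT ε hε
    obtain ⟨δ, hδ, H⟩ := hY t ht0 htT ε hε
    refine ⟨δ, hδ, fun v hv ↦ ?_⟩
    obtain ⟨N, P, h0, hN, hP, rfl⟩ := hv.exists_partition
    rw [hY0]
    exact H N P h0 hN hP
  have hlocal : ∀ s t, 0 ≤ s → s ≤ t → t ≤ T → K * (t - s) ^ β ≤ c →
      ‖Y t - Y s‖ ≤ D * K * (t - s) ^ β := by
    intro s t hs hst ht hsmall
    have hx : (Cv + 1) * K * (t - s) ^ β ≤ κ := by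
      rw [hc, le_div_iff₀ hL] at hsmall
      linarith
    have := norm_sub_le_of_hasRiemannIntegral hL.le hK hθdef hθ hθ1 hV hVL hX' hint
      hs hst ht (hx.trans hκ1) (hx.trans hκ2)
    rw [hD]
    linarith
  have hglobal : ∀ u v, 0 ≤ u → u ≤ v → v ≤ T →
      ‖Y v - Y u‖ ≤ B * max K (K ^ (1 / β)) * (v - u) ^ β := fun u v hu huv hv ↦
    norm_sub_le_of_local_holder hβ0 hβ1.le hK hc0 hD0.le hlocal hu huv hv
  have hmax : 0 ≤ max K (K ^ (1 / β)) := hK.trans (le_max_left _ _)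
  have hTβ : 0 ≤ T ^ β := Real.rpow_nonneg hT.le _
  refine ⟨holderSemi_le (by positivity) fun u v hu huv hv ↦ ?_, ?_, ?_⟩
  · refine (hglobal u v hu huv.le hv).trans ?_
    have : 0 ≤ (v - u) ^ β := Real.rpow_nonneg (by linarith) _
    gcongr
    exact le_mul_of_one_le_right hB0.le (by linarith)
  · refine Real.sSup_le ?_ (by positivity)
    rintro _ ⟨u, hu, huT, rfl⟩
    have h1 := hglobal 0 u le_rfl hu huT
    rw [hY0, sub_zero] at h1
    have h2 : B * max K (K ^ (1 / β)) * u ^ β ≤ B * (1 + T ^ β) * max K (K ^ (1 / β)) := by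
      have h3 : u ^ β ≤ 1 + T ^ β :=
        (Real.rpow_le_rpow hu huT hβ0.le).trans (by linarith)
      calc B * max K (K ^ (1 / β)) * u ^ β
          ≤ B * max K (K ^ (1 / β)) * (1 + T ^ β) := by gcongr
        _ = B * (1 + T ^ β) * max K (K ^ (1 / β)) := by ring
    have h4 := norm_add_le y (Y u - y)
    rw [add_sub_cancel] at h4
    linarith
  · intro s t hs hst ht hsmall
    refine holderSemi_le (by positivity) fun u v hu huv hv ↦ ?_
    refine hlocal u v (hs.trans hu) huv.le (hv.trans ht) (le_trans ?_ hsmall)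
    have : 0 ≤ v - u := by linarith
    gcongr
end
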